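/- arXiv:2507.20482 — 3 statements merged into one kernel-verified Lean document; each statement's English description precedes it below -/
import Mathlib

section
/- Let q ≥ 2 be an integer and β > q. There exists a constant A > 0 such that for all sufficiently large n, if X is distributed according to the mean-field q-state Potts measure μ, then ‖α(X) − m‖_∞ ≤ A/√n with probability at least 3/4. -/
open scoped Classical
open Finset

/-- Spin configurations on `n` vertices with `q` spins. -/
abbrev Conf (n q : ℕ) := Fin n → Fin q

/-- Number of vertices assigned spin `j`. -/
def cntN {n q : ℕ} (X : Conf n q) (j : Fin q) : ℕ :=
  (Finset.univ.filter (fun v => X v = j)).card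

/-- Number of monochromatic pairs `{u,v}` (`u < v`, same spin). -/
def numMono {n q : ℕ} (σ : Conf n q) : ℕ :=
  (Finset.univ.filter (fun p : Fin n × Fin n => p.1 < p.2 ∧ σ p.1 = σ p.2)).card

/-- The mean-field `q`-state Potts measure: probability of `σ`. -/
noncomputable def pottsProb (n q : ℕ) (β : ℝ) (σ : Conf n q) : ℝ :=
  Real.exp (β / n * numMono σ) / ∑ τ : Conf n q, Real.exp (β / n * numMono τ)

/-- The set of monochromatic pairs of a configuration. -/
def monoPairs {n q : ℕ} (σ : Conf n q) : Finset (Fin n × Fin n) :=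
  Finset.univ.filter (fun p : Fin n × Fin n => p.1 < p.2 ∧ σ p.1 = σ p.2)

/-- The graph on `Fin n` whose edges are the pairs in `E`. -/
def graphOf {n : ℕ} (E : Finset (Fin n × Fin n)) : SimpleGraph (Fin n) :=
  SimpleGraph.fromRel (fun u v => (u, v) ∈ E)

/-- Number of connected components of the graph `(V, E)`. -/
noncomputable def numComps {n : ℕ} (E : Finset (Fin n × Fin n)) : ℕ :=
  Nat.card (graphOf E).ConnectedComponent

/-- One-step transition probability of the Swendsen–Wang dynamics:
percolate on monochromatic pairs with probability `p = 1 - exp (-β/n)`,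
then color each connected component uniformly at random. -/
noncomputable def swStep (n q : ℕ) (β : ℝ) (σ τ : Conf n q) : ℝ :=
  ∑ E ∈ (monoPairs σ).powerset,
    ((1 - Real.exp (-(β / n))) ^ E.card *
        Real.exp (-(β / n)) ^ ((monoPairs σ).card - E.card)) *
      (if ∀ u v : Fin n, (graphOf E).Reachable u v → τ u = τ v then
        ((q : ℝ))⁻¹ ^ numComps E else 0)

/-- `t`-step transition probability of the Swendsen–Wang dynamics. -/
noncomputable def swProb (n q : ℕ) (β : ℝ) : ℕ → Conf n q → Conf n q → ℝ
  | 0, σ, τ => if σ = τ then 1 else 0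
  | t + 1, σ, τ => ∑ η : Conf n q, swStep n q β σ η * swProb n q β t η τ

/-- Probability of observing the trajectory `ω 0, ω 1, …, ω (ℓ-1)` at times
`1, …, ℓ` for the SW dynamics started at `X₀`. -/
noncomputable def pathProb (n q : ℕ) (β : ℝ) (X₀ : Conf n q) (ℓ : ℕ)
    (ω : Fin ℓ → Conf n q) : ℝ :=
  ∏ i : Fin ℓ, swStep n q β
    (if _h : 0 < (i : ℕ) then
        ω ⟨(i : ℕ) - 1, lt_of_le_of_lt (Nat.sub_le _ _) i.isLt⟩
      else X₀) (ω i)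

/-- Total variation distance between two probability vectors on configurations. -/
noncomputable def tvDist {n q : ℕ} (f g : Conf n q → ℝ) : ℝ :=
  (∑ τ : Conf n q, |f τ - g τ|) / 2

/-- Mixing time `τ_mix(ε)` of the SW dynamics. -/
noncomputable def mixingTime (n q : ℕ) (β ε : ℝ) : ℕ :=
  sInf {t : ℕ | ∀ σ : Conf n q, tvDist (swProb n q β t σ) (pottsProb n q β) ≤ ε}

/-- `theta lam` is the unique root in `(0,1)` of `exp (-lam * x) = 1 - x`
for `lam > 1`, and `0` for `lam ≤ 1`. -/
noncomputable def theta (lam : ℝ) : ℝ :=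
  if lam ≤ 1 then 0
  else sSup {x : ℝ | x ∈ Set.Ioo (0 : ℝ) 1 ∧ Real.exp (-lam * x) = 1 - x}

/-- The drift function `F`. -/
noncomputable def F (q : ℕ) (β : ℝ) (x : ℝ) : ℝ :=
  1 / q + (1 - 1 / q) * theta (β * x) * x

/-- The unique fixed point of `F` in `(1/q, 1]` (for `β > q`). -/
noncomputable def aFix (q : ℕ) (β : ℝ) : ℝ :=
  sSup {x : ℝ | x ∈ Set.Ioc (1 / (q : ℝ)) 1 ∧ F q β x = x}

/-- The cutoff constant `c(β,q) = (2 log (1 / F'(a)))⁻¹`. -/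
noncomputable def cConst (q : ℕ) (β : ℝ) : ℝ :=
  (2 * Real.log (1 / deriv (F q β) (aFix q β)))⁻¹

/-- Fraction of vertices assigned spin `j`. -/
noncomputable def cntFrac {n q : ℕ} (X : Conf n q) : Fin q → ℝ :=
  fun j => (cntN X j : ℝ) / n

/-- The proportions vector `α(X)`: fractions of vertices of each spin,
sorted in nonincreasing order. -/
noncomputable def alphaVec {n q : ℕ} (X : Conf n q) : Fin q → ℝ :=
  fun i => cntFrac X (Tuple.sort (cntFrac X) i.rev)

/-- `ℓ∞` distance between two vectors indexed by `Fin q`. -/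
noncomputable def linf {q : ℕ} (f g : Fin q → ℝ) : ℝ :=
  ⨆ i : Fin q, |f i - g i|

/-- The vector `κ(b) = (b, (1-b)/(q-1), …, (1-b)/(q-1))`. -/
noncomputable def kappaVec (q : ℕ) (b : ℝ) : Fin q → ℝ :=
  fun i => if (i : ℕ) = 0 then b else (1 - b) / ((q : ℝ) - 1)

/-- The majority vector `m = (a, (1-a)/(q-1), …, (1-a)/(q-1))`. -/
noncomputable def mVec (q : ℕ) (β : ℝ) : Fin q → ℝ :=
  kappaVec q (aFix q β)

/-- Index of the most common spin of `X` (least such index on ties). -/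
noncomputable def domIdx {n q : ℕ} (X : Conf n q) : ℕ :=
  sInf {j : ℕ | ∃ hj : j < q, ∀ j' : Fin q, cntN X j' ≤ cntN X ⟨j, hj⟩}

/-- `α₁(X)`: fraction of vertices carrying the most common spin of `X`. -/
noncomputable def alpha1 {n q : ℕ} (X : Conf n q) : ℝ :=
  ((Finset.univ.filter (fun v : Fin n => (X v : ℕ) = domIdx X)).card : ℝ) / n

/-- `α_{1,k}(X)`: fraction of vertices of `Vk` carrying the most common spin of `X`. -/
noncomputable def alpha1In {n q : ℕ} (X : Conf n q) (Vk : Finset (Fin n)) : ℝ :=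
  ((Vk.filter (fun v => (X v : ℕ) = domIdx X)).card : ℝ) / Vk.card

/-- `P` is a partition of the vertex set into `q` classes. -/
def IsPartition {n q : ℕ} (P : Fin q → Finset (Fin n)) : Prop :=
  (∀ i j, i ≠ j → Disjoint (P i) (P j)) ∧ ∀ v : Fin n, ∃ i, v ∈ P i

/-- A `λ`-partition: a partition with all classes of size at least `λ n`. -/
def IsLamPartition {n q : ℕ} (lam : ℝ) (P : Fin q → Finset (Fin n)) : Prop :=
  IsPartition P ∧ ∀ i, lam * n ≤ ((P i).card : ℝ)

/-- Projection: `projCnt P X i j` is the number of vertices of `P i`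
assigned spin `j` in `X`. -/
def projCnt {n q : ℕ} (P : Fin q → Finset (Fin n)) (X : Conf n q) :
    Fin q → Fin q → ℕ :=
  fun i j => ((P i).filter (fun v => X v = j)).card

/-- All potential edges of the complete graph on `Fin n`. -/
def allPairs (n : ℕ) : Finset (Fin n × Fin n) :=
  Finset.univ.filter (fun p : Fin n × Fin n => p.1 < p.2)

/-- Probability of the edge set `E` under the Erdős–Rényi measure `G(n,p)`. -/
noncomputable def erProb (n : ℕ) (p : ℝ) (E : Finset (Fin n × Fin n)) : ℝ :=
  p ^ E.card * (1 - p) ^ ((allPairs n).card - E.card)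

/-- Size of the connected component of `v` in the graph `(V, E)`. -/
noncomputable def compCard {n : ℕ} (E : Finset (Fin n × Fin n)) (v : Fin n) : ℕ :=
  (Finset.univ.filter (fun u => (graphOf E).Reachable v u)).card

/-- `L₁`: size of the largest connected component. -/
noncomputable def L1 {n : ℕ} (E : Finset (Fin n × Fin n)) : ℕ :=
  Finset.univ.sup (fun v => compCard E v)

/-- Sum of the squares of the component sizes, `Σ_j L_j²`
(computed as `Σ_v |C(v)|`). -/
noncomputable def sumCompSq {n : ℕ} (E : Finset (Fin n × Fin n)) : ℕ :=
  ∑ v : Fin n, compCard E v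

/-- Expectation of `f` under the Erdős–Rényi measure `G(n,p)`. -/
noncomputable def erExp (n : ℕ) (p : ℝ) (f : Finset (Fin n × Fin n) → ℝ) : ℝ :=
  ∑ E ∈ (allPairs n).powerset, erProb n p E * f E

/-- Random-cluster weight of an edge set with parameters `q`, `p = 1 - exp (-β/n)`. -/
noncomputable def rcWeight (n q : ℕ) (β : ℝ) (E : Finset (Fin n × Fin n)) : ℝ :=
  (1 - Real.exp (-(β / n))) ^ E.card *
    Real.exp (-(β / n)) ^ ((allPairs n).card - E.card) * (q : ℝ) ^ numComps E

/-- The mean-field random-cluster measure: probability of the edge set `E`. -/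
noncomputable def rcProb (n q : ℕ) (β : ℝ) (E : Finset (Fin n × Fin n)) : ℝ :=
  rcWeight n q β E / ∑ B ∈ (allPairs n).powerset, rcWeight n q β B


/-- Two distinct solutions of `exp (β t) = S t` lie on opposite sides of `1 / β`. -/
lemma exp_eq_mul_separated {β S x y : ℝ} (hx : 0 < x) (hxy : x < y)
    (hex : Real.exp (β * x) = S * x) (hey : Real.exp (β * y) = S * y) :
    β * x < 1 ∧ 1 < β * y := by
  have hy : 0 < y := hx.trans hxy
  have key : Real.exp (β * (y - x)) = y / x := by
    have hS : S ≠ 0 := by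
      rintro rfl
      exact absurd hex (by simp)
    rw [mul_sub, Real.exp_sub, hex, hey]
    field_simp
  have hlog : Real.log (y / x) = β * (y - x) := by rw [← key, Real.log_exp]
  have hne : y / x ≠ 1 := by
    rw [Ne, div_eq_one_iff_eq hx.ne']; exact hxy.ne'
  have hne' : x / y ≠ 1 := by
    rw [Ne, div_eq_one_iff_eq hy.ne']; exact hxy.ne
  have h1 := Real.log_lt_sub_one_of_pos (div_pos hy hx) hne
  have h2 := Real.log_lt_sub_one_of_pos (div_pos hx hy) hne'
  have hlog' : Real.log (x / y) = -(β * (y - x)) := by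
    rw [← hlog, ← Real.log_inv, inv_div]
  have e1 : y / x - 1 = (y - x) / x := by field_simp
  have e2 : x / y - 1 = -((y - x) / y) := by field_simp; ring
  rw [hlog, e1, lt_div_iff₀ hx] at h1
  rw [hlog', e2, neg_lt_neg_iff, div_lt_iff₀ hy] at h2
  constructor <;> nlinarith [sub_pos.2 hxy]

/-- The one-dimensional mean-field equation in terms of the magnetization `s`. -/
noncomputable def magEq (r β s : ℝ) : ℝ :=
  Real.log (1 + (r - 1) * s) - Real.log (1 - s) - β * s

lemma exists_critical_between {r β s t : ℝ} (hr : 1 < r) (hs : 0 ≤ s) (hst : s < t)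
    (ht : t < 1) (h : magEq r β s = magEq r β t) :
    ∃ c ∈ Set.Ioo s t, β * ((1 + (r - 1) * c) * (1 - c)) = r := by
  have hd : ∀ x ∈ Set.Icc s t, HasDerivAt (magEq r β)
      ((r - 1) / (1 + (r - 1) * x) - (-1) / (1 - x) - β) x := by
    intro x hx
    have h1 : 0 < 1 + (r - 1) * x := by nlinarith [hx.1]
    have h2 : 0 < 1 - x := by linarith [hx.2]
    have d1 : HasDerivAt (fun x : ℝ => 1 + (r - 1) * x) (r - 1) x := by
      simpa using ((hasDerivAt_id x).const_mul (r - 1)).const_add 1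
    have d2 : HasDerivAt (fun x : ℝ => 1 - x) (-1) x := by
      simpa using (hasDerivAt_id x).const_sub 1
    have d3 : HasDerivAt (fun x : ℝ => β * x) β x := by
      simpa using (hasDerivAt_id x).const_mul β
    exact ((d1.log h1.ne').sub (d2.log h2.ne')).sub d3
  obtain ⟨c, hc, h0⟩ := exists_hasDerivAt_eq_zero hst
    (fun x hx => (hd x hx).continuousAt.continuousWithinAt) h
    (fun x hx => hd x (Set.Ioo_subset_Icc_self hx))
  refine ⟨c, hc, ?_⟩
  have h1 : 0 < 1 + (r - 1) * c := by nlinarith [hc.1]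
  have h2 : 0 < 1 - c := by linarith [hc.2]
  field_simp at h0
  linarith

lemma magEq_zero (r β : ℝ) : magEq r β 0 = 0 := by simp [magEq]

lemma magEq_root_unique {r β s t : ℝ} (hr : 1 < r) (hβ : r < β) (hs : 0 < s) (hs1 : s < 1)
    (ht : 0 < t) (ht1 : t < 1) (h : magEq r β s = 0) (h' : magEq r β t = 0) : s = t := by
  wlog hst : s < t generalizing s t
  · rcases lt_trichotomy s t with h1 | h1 | h1
    · exact absurd h1 hst
    · exact h1
    · exact (this ht ht1 hs hs1 h' h h1).symm
  exfalso
  have hβ0 : 0 < β := by linarith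
  obtain ⟨c, hc, e1⟩ := exists_critical_between hr le_rfl hs hs1 ((magEq_zero r β).trans h.symm)
  obtain ⟨d, hd, e2⟩ := exists_critical_between hr hs.le hst ht1 (h.trans h'.symm)
  have hcd : c < d := hc.2.trans hd.1
  have e3 : (d - c) * ((r - 2) - (r - 1) * (c + d)) = 0 := by
    have : β * ((d - c) * ((r - 2) - (r - 1) * (c + d))) = 0 := by linear_combination e2 - e1
    exact (mul_eq_zero.1 this).resolve_left hβ0.ne'
  have e4 : (r - 2) - (r - 1) * (c + d) = 0 :=
    (mul_eq_zero.1 e3).resolve_left (sub_pos.2 hcd).ne'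
  have e5 : β * (1 + (r - 1) * (c * d)) = r := by linear_combination e1 - β * c * e4
  have : 0 < (r - 1) * (c * d) :=
    mul_pos (by linarith) (mul_pos hc.1 (hc.1.trans hcd))
  nlinarith

lemma magEq_root_slope {r β s : ℝ} (hr : 1 < r) (hβ : r < β) (hs : 0 < s) (hs1 : s < 1)
    (h : magEq r β s = 0) : β * ((1 + (r - 1) * s) * (1 - s)) < r := by
  have hβ0 : 0 < β := by linarith
  obtain ⟨c, hc, e1⟩ := exists_critical_between hr le_rfl hs hs1 ((magEq_zero r β).trans h.symm)
  by_contra! hle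
  have e3 : 0 ≤ (s - c) * ((r - 2) - (r - 1) * (c + s)) := by
    have : 0 ≤ β * ((s - c) * ((r - 2) - (r - 1) * (c + s))) := by nlinarith
    exact nonneg_of_mul_nonneg_right this hβ0
  have e4 : 0 ≤ (r - 2) - (r - 1) * (c + s) :=
    nonneg_of_mul_nonneg_right e3 (sub_pos.2 hc.2)
  have e5 : β * (1 + (r - 1) * (c * s)) ≤ r := by nlinarith [mul_nonneg (mul_pos hβ0 hc.1).le e4]
  have : 0 < (r - 1) * (c * s) :=
    mul_pos (by linarith) (mul_pos hc.1 hs)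
  nlinarith

/-- `(a, b, …, b)` (with `r` entries) is an ordered solution of the mean-field equation. -/
structure IsMeanFieldPair (r β a b : ℝ) : Prop where
  pos : 0 < b
  lt : b < a
  sum_eq : a + (r - 1) * b = 1
  exp_eq : Real.exp (β * (a - b)) * b = a

lemma IsMeanFieldPair.magEq_eq {r β a b : ℝ} (hr : 1 < r) (h : IsMeanFieldPair r β a b) :
    0 < a - b ∧ a - b < 1 ∧ magEq r β (a - b) = 0 := by
  obtain ⟨h0, h1, h2, h3⟩ := h
  have e1 : 1 + (r - 1) * (a - b) = r * a := by linear_combination -h2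
  have e2 : 1 - (a - b) = r * b := by linear_combination -h2
  have hrb : 0 < r * b := by positivity
  refine ⟨by linarith, by linarith, ?_⟩
  have ha : 0 < a := h0.trans h1
  rw [magEq, e1, e2, Real.log_mul (by positivity) ha.ne', Real.log_mul (by positivity) h0.ne']
  have := congrArg Real.log h3
  rw [Real.log_mul (Real.exp_pos _).ne' h0.ne', Real.log_exp] at this
  linarith

lemma IsMeanFieldPair.unique {r β a b a' b' : ℝ} (hr : 1 < r) (hβ : r < β)
    (h : IsMeanFieldPair r β a b) (h' : IsMeanFieldPair r β a' b') : a = a' ∧ b = b' := by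
  obtain ⟨p1, p2, p3⟩ := h.magEq_eq hr
  obtain ⟨p1', p2', p3'⟩ := h'.magEq_eq hr
  have e := magEq_root_unique hr hβ p1 p2 p1' p2' p3 p3'
  have e1 := h.sum_eq
  have e2 := h'.sum_eq
  have e3 : r * (b - b') = 0 := by linear_combination e1 - e2 - e
  have e4 := (mul_eq_zero.1 e3).resolve_left (by linarith)
  exact ⟨by linarith, by linarith⟩

lemma IsMeanFieldPair.mul_lt_one {r β a b : ℝ} (hr : 1 < r) (hβ : r < β)
    (h : IsMeanFieldPair r β a b) : β * (r * (a * b)) < 1 := by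
  obtain ⟨p1, p2, p3⟩ := h.magEq_eq hr
  have hh := magEq_root_slope hr hβ p1 p2 p3
  have h2 := h.sum_eq
  have e1 : 1 + (r - 1) * (a - b) = r * a := by linear_combination -h2
  have e2 : 1 - (a - b) = r * b := by linear_combination -h2
  rw [e1, e2] at hh
  have : r * (β * (r * (a * b))) < r * 1 := by linarith
  exact lt_of_mul_lt_mul_left this (by linarith)

lemma exp_neg_eq_one_sub_unique {l x y : ℝ} (hx : 0 < x) (hxy : x < y)
    (h1 : Real.exp (-l * x) = 1 - x) (h2 : Real.exp (-l * y) = 1 - y) : False := by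
  have hy : 0 < y := hx.trans hxy
  have hl : l ≠ 0 := by
    rintro rfl
    simp at h1
    linarith
  have hne : -l * y ≠ 0 := mul_ne_zero (neg_ne_zero.2 hl) hy.ne'
  have := strictConvexOn_exp.2 (Set.mem_univ (-l * y)) (Set.mem_univ 0) hne
    (div_pos hx hy) (div_pos (sub_pos.2 hxy) hy) (by field_simp; ring)
  have e : (x / y) • (-l * y) + ((y - x) / y) • (0 : ℝ) = -l * x := by
    simp only [smul_eq_mul]; field_simp; ring
  rw [e, h1, h2] at this
  simp only [smul_eq_mul, Real.exp_zero] at this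
  have e2 : x / y * (1 - y) + (y - x) / y * 1 = 1 - x := by field_simp; ring
  linarith


lemma theta_eq_of_root {l x : ℝ} (hl : 1 < l) (hx : 0 < x) (hx1 : x < 1)
    (h : Real.exp (-l * x) = 1 - x) : theta l = x := by
  have : {y : ℝ | y ∈ Set.Ioo (0 : ℝ) 1 ∧ Real.exp (-l * y) = 1 - y} = {x} := by
    ext y
    constructor
    · rintro ⟨hy, h'⟩
      rcases lt_trichotomy x y with h1 | h1 | h1
      · exact (exp_neg_eq_one_sub_unique hx h1 h h').elim
      · exact h1.symm
      · exact (exp_neg_eq_one_sub_unique hy.1 h1 h' h).elim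
    · rintro rfl
      exact ⟨⟨hx, hx1⟩, h⟩
  rw [theta, if_neg hl.not_ge, this, csSup_singleton]

lemma exists_root_of_theta_ne_zero {l : ℝ} (h : theta l ≠ 0) :
    1 < l ∧ 0 < theta l ∧ theta l < 1 ∧ Real.exp (-l * theta l) = 1 - theta l := by
  have hl : 1 < l := by
    by_contra! hl
    exact h (by rw [theta, if_pos hl])
  have hne : {y : ℝ | y ∈ Set.Ioo (0 : ℝ) 1 ∧ Real.exp (-l * y) = 1 - y}.Nonempty := by
    by_contra hne
    rw [Set.not_nonempty_iff_eq_empty] at hne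
    exact h (by rw [theta, if_neg hl.not_ge, hne, Real.sSup_empty])
  obtain ⟨y, hy, hy'⟩ := hne
  rw [theta_eq_of_root hl hy.1 hy.2 hy']
  exact ⟨hl, hy.1, hy.2, hy'⟩

lemma isMeanFieldPair_of_fixed {q : ℕ} {β x : ℝ} (hq : 2 ≤ q)
    (hx : x ∈ Set.Ioc (1 / (q : ℝ)) 1) (h : F q β x = x) :
    IsMeanFieldPair q β x ((1 - x) / ((q : ℝ) - 1)) := by
  have hq2 : (2 : ℝ) ≤ q := by exact_mod_cast hq
  have hq0 : (0 : ℝ) < q := by linarith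
  have hq1 : (0 : ℝ) < q - 1 := by linarith
  have hx0 : 0 < x := lt_trans (by positivity) hx.1
  rw [F] at h
  have hth : theta (β * x) ≠ 0 := by
    intro h0
    rw [h0] at h
    linarith [hx.1]
  obtain ⟨-, t0, t1, t2⟩ := exists_root_of_theta_ne_zero hth
  set t := theta (β * x)
  have hs : t * x < 1 := by nlinarith [hx.2]
  have hb : (1 - x) / ((q : ℝ) - 1) = (1 - t * x) / q := by
    field_simp at h ⊢
    linarith
  have hd : x - (1 - t * x) / q = t * x := by
    field_simp at h ⊢
    linarith
  refine ⟨?_, ?_, by field_simp; ring, ?_⟩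
  · rw [hb]; exact div_pos (by linarith) hq0
  · rw [hb]; nlinarith [mul_pos t0 hx0]
  · have e2 : Real.exp (β * (t * x)) = (1 - t)⁻¹ := by
      rw [← t2, ← Real.exp_neg]; congr 1; ring
    rw [hb, hd, e2]
    have e3 : (1 - t * x) / q = (1 - t) * x := by linarith
    rw [e3, inv_mul_cancel_left₀ (by linarith)]

lemma IsMeanFieldPair.fixed {q : ℕ} {β a b : ℝ} (hq : 2 ≤ q) (hβ : (q : ℝ) < β)
    (h : IsMeanFieldPair q β a b) : a ∈ Set.Ioc (1 / (q : ℝ)) 1 ∧ F q β a = a := by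
  have hq2 : (2 : ℝ) ≤ q := by exact_mod_cast hq
  have hq0 : (0 : ℝ) < q := by linarith
  obtain ⟨h0, h1, h2, h3⟩ := h
  have ha : 0 < a := h0.trans h1
  have haq : 1 < q * a := by nlinarith
  have hβa : 1 < β * a := by nlinarith
  have hroot : theta (β * a) = (a - b) / a := by
    refine theta_eq_of_root hβa (div_pos (by linarith) ha) ?_ ?_
    · rw [div_lt_one ha]; linarith
    · have e : -(β * a) * ((a - b) / a) = -(β * (a - b)) := by field_simp
      have e' : 1 - (a - b) / a = b / a := by field_simp; ring
      rw [e, e', Real.exp_neg, (eq_div_iff h0.ne').2 h3, inv_div]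
  refine ⟨⟨?_, by nlinarith⟩, ?_⟩
  · rw [div_lt_iff₀ hq0]; linarith
  · rw [F, hroot]
    field_simp
    linear_combination -h2

lemma IsMeanFieldPair.aFix_eq {q : ℕ} {β a b : ℝ} (hq : 2 ≤ q) (hβ : (q : ℝ) < β)
    (h : IsMeanFieldPair q β a b) : aFix q β = a := by
  have hq2 : (2 : ℝ) ≤ q := by exact_mod_cast hq
  have : {x : ℝ | x ∈ Set.Ioc (1 / (q : ℝ)) 1 ∧ F q β x = x} = {a} := by
    ext x
    constructor
    · rintro ⟨hx, hx'⟩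
      exact ((isMeanFieldPair_of_fixed hq hx hx').unique (by linarith) hβ h).1
    · rintro rfl
      exact h.fixed hq hβ
  rw [aFix, this, csSup_singleton]

/-- Squared Euclidean norm of a vector. -/
def sqNorm {q : ℕ} (v : Fin q → ℝ) : ℝ := ∑ i, v i ^ 2

/-- The Gaussian-linearized mean-field free energy. -/
noncomputable def freeEnergy {q : ℕ} (β : ℝ) (y : Fin q → ℝ) : ℝ :=
  β / 2 * sqNorm y - Real.log (∑ i, Real.exp (β * y i))

/-- The vector with entry `a` at `j` and `b` elsewhere. -/
def peak {q : ℕ} (a b : ℝ) (j : Fin q) : Fin q → ℝ := fun i => if i = j then a else b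

lemma sqNorm_nonneg {q : ℕ} (v : Fin q → ℝ) : 0 ≤ sqNorm v :=
  Finset.sum_nonneg fun _ _ => sq_nonneg _

lemma sq_le_sqNorm {q : ℕ} (v : Fin q → ℝ) (i : Fin q) : v i ^ 2 ≤ sqNorm v :=
  Finset.single_le_sum (f := fun i => v i ^ 2) (fun _ _ => sq_nonneg _) (Finset.mem_univ i)

lemma sqNorm_add_le {q : ℕ} (v w : Fin q → ℝ) : sqNorm (v + w) ≤ 2 * sqNorm v + 2 * sqNorm w := by
  simp only [sqNorm, Finset.mul_sum, ← Finset.sum_add_distrib]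
  refine Finset.sum_le_sum fun i _ => ?_
  rw [Pi.add_apply]
  nlinarith [sq_nonneg (v i - w i)]

@[fun_prop]
lemma continuous_sqNorm {q : ℕ} : Continuous (sqNorm : (Fin q → ℝ) → ℝ) := by
  unfold sqNorm; fun_prop

lemma sum_exp_pos {q : ℕ} [NeZero q] (β : ℝ) (y : Fin q → ℝ) : 0 < ∑ i, Real.exp (β * y i) :=
  Finset.sum_pos (fun _ _ => Real.exp_pos _) Finset.univ_nonempty

lemma continuous_freeEnergy {q : ℕ} [NeZero q] (β : ℝ) :
    Continuous (freeEnergy β : (Fin q → ℝ) → ℝ) := by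
  unfold freeEnergy
  refine Continuous.sub (by fun_prop) (Continuous.log (by fun_prop) fun y => (sum_exp_pos β y).ne')

lemma sum_peak {q : ℕ} (g : ℝ → ℝ) (a b : ℝ) (j : Fin q) :
    ∑ i, g (peak a b j i) = g a + ((q : ℝ) - 1) * g b := by
  have : ∀ i, g (peak a b j i) = g b + if i = j then g a - g b else 0 := by
    intro i; unfold peak; split_ifs <;> ring
  simp only [this, Finset.sum_add_distrib, Finset.sum_ite_eq', Finset.mem_univ, if_true,
    Finset.sum_const, Finset.card_univ, Fintype.card_fin, nsmul_eq_mul]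
  ring

lemma freeEnergy_peak {q : ℕ} (β a b : ℝ) (j : Fin q) :
    freeEnergy β (peak a b j) = β / 2 * (a ^ 2 + ((q : ℝ) - 1) * b ^ 2) -
      Real.log (Real.exp (β * a) + ((q : ℝ) - 1) * Real.exp (β * b)) := by
  rw [freeEnergy, sqNorm, sum_peak (fun x => x ^ 2), sum_peak (fun x => Real.exp (β * x))]

lemma freeEnergy_coercive {q : ℕ} [NeZero q] {β : ℝ} (hβ : 0 < β) (y : Fin q → ℝ) :
    β / 4 * sqNorm y - (Real.log q + β) ≤ freeEnergy β y := by
  have hq : (0 : ℝ) < q := by exact_mod_cast Nat.pos_of_neZero q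
  have h1 : ∑ i, Real.exp (β * y i) ≤ q * Real.exp (β * (sqNorm y / 4 + 1)) := by
    have : ∀ i ∈ (Finset.univ : Finset (Fin q)),
        Real.exp (β * y i) ≤ Real.exp (β * (sqNorm y / 4 + 1)) := by
      intro i _
      gcongr
      nlinarith [sq_le_sqNorm y i, sq_nonneg (y i / 2 - 1)]
    simpa using Finset.sum_le_sum this
  have h2 := Real.log_le_log (sum_exp_pos β y) h1
  rw [Real.log_mul hq.ne' (Real.exp_pos _).ne', Real.log_exp] at h2
  rw [freeEnergy]
  linarith

lemma isCompact_sqNorm_le {q : ℕ} (R : ℝ) : IsCompact {y : Fin q → ℝ | sqNorm y ≤ R} := by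
  refine (isCompact_univ_pi (s := fun _ : Fin q => Set.Icc (-(R + 1)) (R + 1))
    fun _ => isCompact_Icc).of_isClosed_subset
    (isClosed_le continuous_sqNorm continuous_const) ?_
  intro y hy i _
  have h1 := (sq_le_sqNorm y i).trans hy
  constructor <;> nlinarith [sq_nonneg (y i - 1), sq_nonneg (y i + 1)]

lemma exists_isMin_freeEnergy {q : ℕ} [NeZero q] {β : ℝ} (hβ : 0 < β) :
    ∃ x : Fin q → ℝ, ∀ y : Fin q → ℝ, freeEnergy β x ≤ freeEnergy β y := by
  refine (continuous_freeEnergy β).exists_forall_le' 0 ?_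
  refine Filter.mem_cocompact.2 ⟨_, isCompact_sqNorm_le
    ((freeEnergy β (0 : Fin q → ℝ) + (Real.log q + β)) / (β / 4)), ?_⟩
  intro y hy
  simp only [Set.mem_compl_iff, Set.mem_ofPred_eq, not_le] at hy ⊢
  rw [div_lt_iff₀ (by positivity)] at hy
  linarith [freeEnergy_coercive hβ y]

lemma exp_eq_of_isMin {q : ℕ} [NeZero q] {β : ℝ} (hβ : 0 < β) {y : Fin q → ℝ}
    (hy : ∀ z : Fin q → ℝ, freeEnergy β y ≤ freeEnergy β z) (i : Fin q) :
    Real.exp (β * y i) = (∑ k, Real.exp (β * y k)) * y i := by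
  set S := ∑ k, Real.exp (β * y k) with hS
  have hS0 : 0 < S := sum_exp_pos β y
  have hf : ∀ t : ℝ, freeEnergy β (fun k => y k + if k = i then t else 0) =
      β / 2 * (sqNorm y + (2 * t * y i + t ^ 2)) -
        Real.log (S + Real.exp (β * y i) * (Real.exp (β * t) - 1)) := by
    intro t
    have e1 : ∀ k, (y k + if k = i then t else 0) ^ 2 =
        y k ^ 2 + if k = i then 2 * t * y k + t ^ 2 else 0 := by
      intro k; split_ifs <;> ring
    have e2 : ∀ k, Real.exp (β * (y k + if k = i then t else 0)) =
        Real.exp (β * y k) + if k = i then Real.exp (β * y k) * (Real.exp (β * t) - 1) else 0 := by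
      intro k; split_ifs
      · rw [mul_add, Real.exp_add]; ring
      · simp
    simp only [freeEnergy, sqNorm, e1, e2, Finset.sum_add_distrib, Finset.sum_ite_eq',
      Finset.mem_univ, if_true, hS]
  have hmin : IsLocalMin (fun t : ℝ => β / 2 * (sqNorm y + (2 * t * y i + t ^ 2)) -
        Real.log (S + Real.exp (β * y i) * (Real.exp (β * t) - 1))) 0 := by
    refine Filter.Eventually.of_forall fun t => ?_
    have := hy (fun k => y k + if k = i then t else 0)
    rw [hf] at this
    simpa [freeEnergy, hS] using this
  have hd : HasDerivAt (fun t : ℝ => β / 2 * (sqNorm y + (2 * t * y i + t ^ 2)) -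
        Real.log (S + Real.exp (β * y i) * (Real.exp (β * t) - 1)))
      (β / 2 * (2 * y i) - Real.exp (β * y i) * β / S) 0 := by
    have d1 : HasDerivAt (fun t : ℝ => β / 2 * (sqNorm y + (2 * t * y i + t ^ 2)))
        (β / 2 * (2 * y i)) 0 := by
      have a1 : HasDerivAt (fun t : ℝ => 2 * t * y i) (2 * y i) 0 := by
        simpa using ((hasDerivAt_id (0 : ℝ)).const_mul 2).mul_const (y i)
      have a2 : HasDerivAt (fun t : ℝ => t ^ 2) 0 0 := by
        simpa using hasDerivAt_pow 2 (0 : ℝ)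
      simpa using ((a1.add a2).const_add (sqNorm y)).const_mul (β / 2)
    have d2 : HasDerivAt (fun t : ℝ => S + Real.exp (β * y i) * (Real.exp (β * t) - 1))
        (Real.exp (β * y i) * β) 0 := by
      have a1 : HasDerivAt (fun t : ℝ => Real.exp (β * t)) β 0 := by
        simpa using ((hasDerivAt_id (0 : ℝ)).const_mul β).exp
      exact ((a1.sub_const 1).const_mul _).const_add S
    have d3 := d2.log (by simpa using hS0.ne')
    simp only [mul_zero, Real.exp_zero, sub_self, add_zero] at d3
    exact d1.sub d3
  have := hmin.hasDerivAt_eq_zero hd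
  field_simp at this
  rw [mul_zero] at this
  linarith [(mul_eq_zero.1 this).resolve_left hβ.ne']

lemma two_add_sq_le_exp_add_exp_neg (x : ℝ) : 2 + x ^ 2 ≤ Real.exp x + Real.exp (-x) := by
  wlog hx : 0 ≤ x generalizing x
  · have := this (-x) (by linarith)
    rw [neg_neg, neg_sq] at this
    linarith
  have h1 : x / 2 ≤ Real.sinh (x / 2) := Real.self_le_sinh_iff.2 (by linarith)
  have h2 := Real.cosh_two_mul (x / 2)
  have h3 := Real.cosh_sq (x / 2)
  rw [mul_div_cancel₀ x two_ne_zero, Real.cosh_eq] at h2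
  nlinarith

lemma mul_le_one_of_isMin {q : ℕ} [NeZero q] {β : ℝ} (hβ : 0 < β) {y : Fin q → ℝ}
    (hy : ∀ z : Fin q → ℝ, freeEnergy β y ≤ freeEnergy β z) {i j : Fin q} (hij : i ≠ j) (h : y i = y j) :
    β * y i ≤ 1 := by
  set S := ∑ k, Real.exp (β * y k) with hS
  have hS0 : 0 < S := sum_exp_pos β y
  have hyi := exp_eq_of_isMin hβ hy i
  rw [← hS] at hyi
  have hyi0 : 0 < y i := by
    by_contra! hle
    have := Real.exp_pos (β * y i)
    nlinarith
  have hf : ∀ t : ℝ, freeEnergy β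
        (fun k => y k + ((if k = i then t else 0) + if k = j then -t else 0)) =
      β / 2 * (sqNorm y + 2 * t ^ 2) -
        Real.log (S + S * y i * (Real.exp (β * t) + Real.exp (-(β * t)) - 2)) := by
    intro t
    have e1 : ∀ k, (y k + ((if k = i then t else 0) + if k = j then -t else 0)) ^ 2 =
        y k ^ 2 + ((if k = i then 2 * t * y k + t ^ 2 else 0) +
          if k = j then -2 * t * y k + t ^ 2 else 0) := by
      intro k
      split_ifs with h1 h2
      · exact absurd (h1.symm.trans h2) hij
      all_goals ring
    have e2 : ∀ k, Real.exp (β * (y k + ((if k = i then t else 0) + if k = j then -t else 0))) =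
        Real.exp (β * y k) + ((if k = i then Real.exp (β * y k) * (Real.exp (β * t) - 1) else 0) +
          if k = j then Real.exp (β * y k) * (Real.exp (-(β * t)) - 1) else 0) := by
      intro k
      split_ifs with h1 h2
      · exact absurd (h1.symm.trans h2) hij
      · rw [add_zero, mul_add, Real.exp_add]; ring
      · rw [zero_add, mul_add, Real.exp_add, mul_neg]; ring
      · simp
    simp only [freeEnergy, sqNorm, e1, e2, Finset.sum_add_distrib, Finset.sum_ite_eq',
      Finset.mem_univ, if_true, ← h, hyi, ← hS]
    congr 2 <;> ring
  have key : ∀ x : ℝ, 0 < x → 1 + β * y i * x ≤ Real.exp x := by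
    intro x hx
    have h1 := hy (fun k => y k + ((if k = i then √(x / β) else 0) +
      if k = j then -√(x / β) else 0))
    have hsq : √(x / β) ^ 2 = x / β := Real.sq_sqrt (by positivity)
    rw [hf, freeEnergy, ← hS, hsq] at h1
    have h2 := two_add_sq_le_exp_add_exp_neg (β * √(x / β))
    have e : (β * √(x / β)) ^ 2 = β * x := by rw [mul_pow, hsq]; field_simp
    rw [e] at h2
    set E := Real.exp (β * √(x / β)) + Real.exp (-(β * √(x / β))) - 2
    have hE : β * x ≤ E := by simp only [E]; linarith
    have hE0 : 0 ≤ E := le_trans (by positivity) hE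
    have h3 : Real.log (S + S * y i * E) - Real.log S ≤ x := by
      have : β / 2 * (2 * (x / β)) = x := by field_simp
      linarith
    rw [← Real.log_div (by positivity) hS0.ne', Real.log_le_iff_le_exp (by positivity)] at h3
    have e3 : (S + S * y i * E) / S = 1 + y i * E := by field_simp
    rw [e3] at h3
    nlinarith
  by_contra! hgt
  set g := β * y i - 1
  have hg : 0 < g := by simp only [g]; linarith
  set x := min 1 (g / 2)
  have hx0 : 0 < x := lt_min one_pos (by linarith)
  have hx1 : x ≤ 1 := min_le_left _ _
  have hxg : x ≤ g / 2 := min_le_right _ _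
  have h1 := key x hx0
  have h2 : Real.exp x ≤ 1 + x + x ^ 2 := by
    have := Real.abs_exp_sub_one_sub_id_le (x := x) (by rw [abs_of_pos hx0]; exact hx1)
    linarith [abs_le.1 this]
  have h3 : β * y i = 1 + g := by simp only [g]; ring
  rw [h3] at h1
  nlinarith [mul_pos hx0 hg]

/-- Minimizers of the free energy are peaks at the ordered mean-field pair. -/
lemma isMin_freeEnergy_eq_peak {q : ℕ} [NeZero q] (hq : 2 ≤ q) {β : ℝ} (hβ : (q : ℝ) < β)
    {y : Fin q → ℝ} (hy : ∀ z : Fin q → ℝ, freeEnergy β y ≤ freeEnergy β z) :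
    ∃ a b j, IsMeanFieldPair q β a b ∧ y = peak a b j := by
  have hq2 : (2 : ℝ) ≤ q := by exact_mod_cast hq
  have hβ0 : 0 < β := by linarith
  have hcrit := exp_eq_of_isMin hβ0 hy
  set S := ∑ k, Real.exp (β * y k) with hS
  have hS0 : 0 < S := sum_exp_pos β y
  have hpos : ∀ i, 0 < y i := fun i => by
    have h1 := Real.exp_pos (β * y i)
    rw [hcrit i] at h1
    exact pos_of_mul_pos_right h1 hS0.le
  have hsum : ∑ i, y i = 1 := by
    have : S * ∑ i, y i = S * 1 := by
      rw [Finset.mul_sum, mul_one]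
      conv_rhs => rw [hS]
      exact Finset.sum_congr rfl fun i _ => (hcrit i).symm
    exact mul_left_cancel₀ hS0.ne' this
  obtain ⟨j, hj⟩ : ∃ j, 1 < β * y j := by
    by_contra! hall
    have h1 : ∑ i, β * y i ≤ ∑ i : Fin q, (1 : ℝ) := Finset.sum_le_sum fun i _ => hall i
    rw [← Finset.mul_sum, hsum] at h1
    simp at h1
    linarith
  have hsmall : ∀ i, i ≠ j → y i < y j ∧ β * y i < 1 := by
    intro i hij
    rcases lt_trichotomy (y i) (y j) with h1 | h1 | h1
    · exact ⟨h1, (exp_eq_mul_separated (hpos i) h1 (hcrit i) (hcrit j)).1⟩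
    · exact absurd (mul_le_one_of_isMin hβ0 hy hij.symm h1.symm) hj.not_ge
    · exact absurd (exp_eq_mul_separated (hpos j) h1 (hcrit j) (hcrit i)).1 hj.not_gt
  have heq : ∀ i k, i ≠ j → k ≠ j → y i = y k := by
    intro i k hi hk
    rcases lt_trichotomy (y i) (y k) with h1 | h1 | h1
    · exact absurd (exp_eq_mul_separated (hpos i) h1 (hcrit i) (hcrit k)).2 (hsmall k hk).2.not_gt
    · exact h1
    · exact absurd (exp_eq_mul_separated (hpos k) h1 (hcrit k) (hcrit i)).2 (hsmall i hi).2.not_gt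
  have : Nontrivial (Fin q) := Fin.nontrivial_iff_two_le.2 hq
  obtain ⟨i, hi⟩ := exists_ne j
  have hpk : y = peak (y j) (y i) j := by
    ext k
    unfold peak
    split_ifs with h1
    · rw [h1]
    · exact heq k i h1 hi
  refine ⟨y j, y i, j, ⟨hpos i, (hsmall i hi).1, ?_, ?_⟩, hpk⟩
  · have := sum_peak (fun x => x) (y j) (y i) j
    rw [← hpk, hsum] at this
    exact this.symm
  · rw [mul_sub, Real.exp_sub, hcrit i, hcrit j]
    have := hpos i
    field_simp

lemma exp_le_of_abs_le {x η : ℝ} (hη : η ≤ 1) (hx : |x| ≤ η) :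
    Real.exp x ≤ 1 + x + (1 + η) / 2 * x ^ 2 := by
  have h := Real.exp_bound (hx.trans hη) (n := 3) (by norm_num)
  simp only [Finset.sum_range_succ, Finset.sum_range_zero, Nat.factorial] at h
  norm_num at h
  have h1 := (abs_le.1 h).2
  have h2 : |x| ^ 3 ≤ η * x ^ 2 := by
    rw [pow_succ, sq_abs, mul_comm]
    exact mul_le_mul_of_nonneg_right hx (sq_nonneg x)
  have h3 : 0 ≤ |x| ^ 3 := by positivity
  nlinarith

/-- The variance of `v` under a weight vector `p`, when off-diagonal products are at most `M`. -/
lemma variance_le_mul_sqNorm {q : ℕ} {p v : Fin q → ℝ} {M : ℝ} (hp : ∑ i, p i = 1) (hM : 0 ≤ M)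
    (h : ∀ i j, i ≠ j → p i * p j ≤ M) :
    ∑ i, p i * (v i - ∑ k, p k * v k) ^ 2 ≤ q * M * sqNorm v := by
  set e := ∑ k, p k * v k with he
  have h1 : ∑ i, p i * (v i - e) ^ 2 = ∑ i, p i * v i ^ 2 - e ^ 2 := by
    have : ∀ i, p i * (v i - e) ^ 2 = p i * v i ^ 2 - 2 * e * (p i * v i) + e ^ 2 * p i := by
      intro i; ring
    simp only [this, Finset.sum_add_distrib, Finset.sum_sub_distrib, ← Finset.mul_sum, hp, ← he]
    ring
  have h2 : ∑ i, ∑ j, p i * p j * (v i - v j) ^ 2 = 2 * (∑ i, p i * v i ^ 2 - e ^ 2) := by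
    have : ∀ i j, p i * p j * (v i - v j) ^ 2 =
        p i * v i ^ 2 * p j + p i * (p j * v j ^ 2) - 2 * ((p i * v i) * (p j * v j)) := by
      intro i j; ring
    simp only [this, Finset.sum_add_distrib, Finset.sum_sub_distrib, ← Finset.mul_sum,
      ← Finset.sum_mul, hp, ← he]
    ring
  have h3 : ∑ i, ∑ j, M * (v i - v j) ^ 2 = 2 * M * (q * sqNorm v - (∑ i, v i) ^ 2) := by
    have : ∀ i j, M * (v i - v j) ^ 2 =
        M * v i ^ 2 + M * v j ^ 2 - 2 * M * (v i * v j) := by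
      intro i j; ring
    simp only [this, Finset.sum_add_distrib, Finset.sum_sub_distrib, ← Finset.mul_sum,
      ← Finset.sum_mul, Finset.sum_const, Finset.card_univ, Fintype.card_fin, nsmul_eq_mul, sqNorm]
    ring
  have h4 : ∑ i, ∑ j, p i * p j * (v i - v j) ^ 2 ≤ ∑ i, ∑ j, M * (v i - v j) ^ 2 := by
    refine Finset.sum_le_sum fun i _ => Finset.sum_le_sum fun j _ => ?_
    rcases eq_or_ne i j with rfl | hij
    · simp
    · exact mul_le_mul_of_nonneg_right (h i j hij) (sq_nonneg _)
  rw [h2, h3] at h4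
  rw [h1]
  nlinarith [mul_nonneg hM (sq_nonneg (∑ i, v i))]

lemma IsMeanFieldPair.peak_exp {q : ℕ} {β a b : ℝ} (h : IsMeanFieldPair q β a b)
    (j i : Fin q) : Real.exp (β * peak a b j i) =
      (∑ k, Real.exp (β * peak a b j k)) * peak a b j i := by
  obtain ⟨h0, h1, h2, h3⟩ := h
  have e : Real.exp (β * a) * b = Real.exp (β * b) * a := by
    conv_rhs => rw [← h3]
    rw [← mul_assoc, ← Real.exp_add]
    congr 2; ring
  rw [sum_peak (fun x => Real.exp (β * x))]
  unfold peak
  split_ifs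
  · linear_combination ((q : ℝ) - 1) * e - Real.exp (β * a) * h2
  · linear_combination - e - Real.exp (β * b) * h2

lemma IsMeanFieldPair.peak_pos {q : ℕ} {β a b : ℝ} (h : IsMeanFieldPair q β a b)
    (j i : Fin q) : 0 < peak a b j i := by
  unfold peak
  split_ifs
  · exact h.pos.trans h.lt
  · exact h.pos

lemma IsMeanFieldPair.peak_sum {q : ℕ} {β a b : ℝ} (h : IsMeanFieldPair q β a b)
    (j : Fin q) : ∑ i, peak a b j i = 1 :=
  (sum_peak (fun x => x) a b j).trans h.sum_eq

/-- Quadratic growth of the free energy near a peak. -/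
lemma IsMeanFieldPair.local_growth {q : ℕ} [NeZero q] {β a b : ℝ} (hq : 2 ≤ q)
    (hβ : (q : ℝ) < β) (h : IsMeanFieldPair q β a b) :
    ∃ δ > 0, ∃ c > 0, ∀ (j : Fin q) (v : Fin q → ℝ), sqNorm v < δ →
      freeEnergy β (peak a b j) + c * sqNorm v ≤ freeEnergy β (peak a b j + v) := by
  have hq2 : (2 : ℝ) ≤ q := by exact_mod_cast hq
  have hβ0 : 0 < β := by linarith
  have ha : 0 < a := h.pos.trans h.lt
  have hρ := h.mul_lt_one (by linarith) hβ
  set ρ := β * (q * (a * b)) with hρdef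
  have hρ0 : 0 < ρ := by have := h.pos; positivity
  set η := 1 - ρ with hη
  have hη0 : 0 < η := by linarith
  have hη1 : η ≤ 1 := by linarith
  refine ⟨η ^ 2 / (4 * β ^ 2), by positivity, β / 2 * η ^ 2, by positivity, fun j v hv => ?_⟩
  set p := peak a b j with hp
  set S := ∑ k, Real.exp (β * p k) with hS
  have hS0 : 0 < S := sum_exp_pos β p
  have hp0 : ∀ i, 0 < p i := h.peak_pos j
  have hp1 : ∑ i, p i = 1 := h.peak_sum j
  have hpe : ∀ i, Real.exp (β * p i) = S * p i := h.peak_exp j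
  set e := ∑ k, p k * v k with he
  have hvar : ∑ i, p i * (v i - e) ^ 2 ≤ q * (a * b) * sqNorm v := by
    refine variance_le_mul_sqNorm hp1 (mul_pos ha h.pos).le fun i k hik => ?_
    have h0 := h.pos
    have h1 := h.lt
    simp only [hp, peak]
    split_ifs with h2 h3
    · exact absurd (h2.trans h3.symm) hik
    · exact le_rfl
    · rw [mul_comm]
    · nlinarith
  have he2 : e ^ 2 ≤ sqNorm v := by
    have h1 : e ^ 2 ≤ ∑ i, p i * v i ^ 2 := by
      have : 0 ≤ ∑ i, p i * (v i - e) ^ 2 :=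
        Finset.sum_nonneg fun i _ => mul_nonneg (hp0 i).le (sq_nonneg _)
      have h2 : ∀ i, p i * (v i - e) ^ 2 = p i * v i ^ 2 - 2 * e * (p i * v i) + e ^ 2 * p i := by
        intro i; ring
      simp only [h2, Finset.sum_add_distrib, Finset.sum_sub_distrib, ← Finset.mul_sum, hp1,
        ← he] at this
      linarith
    refine h1.trans (Finset.sum_le_sum fun i _ => ?_)
    have : p i ≤ 1 := by
      rw [← hp1]
      exact Finset.single_le_sum (fun k _ => (hp0 k).le) (Finset.mem_univ i)
    nlinarith [sq_nonneg (v i)]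
  have hu : ∀ i, |β * (v i - e)| ≤ η := by
    intro i
    refine abs_le_of_sq_le_sq ?_ hη0.le
    rw [lt_div_iff₀ (by positivity)] at hv
    have h1 := sq_le_sqNorm v i
    have h2 : (v i - e) ^ 2 ≤ 4 * sqNorm v := by nlinarith [sq_nonneg (v i + e)]
    nlinarith [mul_le_mul_of_nonneg_left h2 (sq_nonneg β)]
  have hT : ∑ i, p i * Real.exp (β * (v i - e)) ≤
      1 + (1 + η) / 2 * β ^ 2 * ∑ i, p i * (v i - e) ^ 2 := by
    have h1 : ∀ i ∈ (Finset.univ : Finset (Fin q)), p i * Real.exp (β * (v i - e)) ≤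
        p i + β * (p i * v i) - β * e * p i
          + (1 + η) / 2 * β ^ 2 * (p i * (v i - e) ^ 2) := by
      intro i _
      have := mul_le_mul_of_nonneg_left (exp_le_of_abs_le hη1 (hu i)) (hp0 i).le
      linarith
    refine (Finset.sum_le_sum h1).trans_eq ?_
    simp only [Finset.sum_add_distrib, Finset.sum_sub_distrib, ← Finset.mul_sum, hp1, ← he]
    ring
  have hsum : ∑ i, Real.exp (β * (p + v) i) =
      S * (Real.exp (β * e) * ∑ i, p i * Real.exp (β * (v i - e))) := by
    rw [Finset.mul_sum, Finset.mul_sum]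
    refine Finset.sum_congr rfl fun i _ => ?_
    rw [Pi.add_apply, mul_add, Real.exp_add, hpe, mul_sub, Real.exp_sub]
    field_simp
  have hT0 : 0 < ∑ i, p i * Real.exp (β * (v i - e)) :=
    Finset.sum_pos (fun i _ => mul_pos (hp0 i) (Real.exp_pos _)) Finset.univ_nonempty
  have hlog := Real.log_le_sub_one_of_pos hT0
  have hnorm : sqNorm (p + v) = sqNorm p + 2 * e + sqNorm v := by
    have : ∀ i, (p + v) i ^ 2 = p i ^ 2 + 2 * (p i * v i) + v i ^ 2 := by
      intro i; rw [Pi.add_apply]; ring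
    simp only [sqNorm, this, Finset.sum_add_distrib, ← Finset.mul_sum, ← he]
  rw [freeEnergy, freeEnergy, hsum, ← hS, hnorm, Real.log_mul hS0.ne' (by positivity),
    Real.log_mul (Real.exp_pos _).ne' hT0.ne', Real.log_exp]
  have hvar2 : (1 + η) / 2 * β ^ 2 * ∑ i, p i * (v i - e) ^ 2 ≤
      (1 + η) / 2 * β ^ 2 * (q * (a * b) * sqNorm v) :=
    mul_le_mul_of_nonneg_left hvar (by positivity)
  have hfin : (1 + η) / 2 * β ^ 2 * (q * (a * b) * sqNorm v) =
      β / 2 * sqNorm v - β / 2 * η ^ 2 * sqNorm v := by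
    have : (1 + η) / 2 * β ^ 2 * (q * (a * b) * sqNorm v) =
      (1 + η) / 2 * β * ρ * sqNorm v := by rw [hρdef]; ring
    rw [this, hη]; ring
  linarith

lemma exists_isMeanFieldPair {q : ℕ} (hq : 2 ≤ q) {β : ℝ} (hβ : (q : ℝ) < β) :
    ∃ a b, IsMeanFieldPair q β a b := by
  have : NeZero q := ⟨by omega⟩
  have hβ0 : 0 < β := lt_of_le_of_lt (Nat.cast_nonneg q) hβ
  obtain ⟨x, hx⟩ := exists_isMin_freeEnergy (q := q) hβ0
  obtain ⟨a, b, _, h, _⟩ := isMin_freeEnergy_eq_peak hq hβ hx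
  exact ⟨a, b, h⟩

/-- The free energy exceeds its minimum by at least a multiple of the squared distance to the
set of peaks. -/
lemma IsMeanFieldPair.global_growth {q : ℕ} [NeZero q] {β a b : ℝ} (hq : 2 ≤ q)
    (hβ : (q : ℝ) < β) (h : IsMeanFieldPair q β a b) :
    ∃ c > 0, ∀ y : Fin q → ℝ, ∃ j : Fin q,
      freeEnergy β (peak a b (0 : Fin q)) + c * sqNorm (y - peak a b j) ≤ freeEnergy β y := by
  have hq2 : (2 : ℝ) ≤ q := by exact_mod_cast hq
  have hβ0 : 0 < β := by linarith
  set G := freeEnergy β (peak a b (0 : Fin q)) with hG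
  have hGj : ∀ j : Fin q, freeEnergy β (peak a b j) = G := fun j => by
    rw [hG, freeEnergy_peak, freeEnergy_peak]
  obtain ⟨x, hx⟩ := exists_isMin_freeEnergy (q := q) hβ0
  have hminval : ∀ z : Fin q → ℝ, (∀ w : Fin q → ℝ, freeEnergy β z ≤ freeEnergy β w) →
      ∃ j, z = peak a b j := by
    intro z hz
    obtain ⟨a', b', j, h', rfl⟩ := isMin_freeEnergy_eq_peak hq hβ hz
    obtain ⟨rfl, rfl⟩ := h'.unique (by linarith) hβ h
    exact ⟨j, rfl⟩
  have hxG : freeEnergy β x = G := by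
    obtain ⟨j, rfl⟩ := hminval x hx
    exact hGj j
  rw [hxG] at hx
  have hgt : ∀ y : Fin q → ℝ, (∀ j, y ≠ peak a b j) → G < freeEnergy β y := by
    intro y hy
    refine lt_of_le_of_ne (hx y) fun he => ?_
    obtain ⟨j, hj⟩ := hminval y fun w => he ▸ hx w
    exact hy j hj
  obtain ⟨δ, hδ, c₁, hc₁, hloc⟩ := h.local_growth hq hβ
  set P := sqNorm (peak a b (0 : Fin q)) with hP
  have hP0 : 0 ≤ P := sqNorm_nonneg _
  have hdist : ∀ y : Fin q → ℝ, sqNorm (y - peak a b 0) ≤ 2 * sqNorm y + 2 * P := by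
    intro y
    have := sqNorm_add_le y (-peak a b 0)
    rw [← sub_eq_add_neg] at this
    simpa [sqNorm, hP] using this
  set K := Real.log q + β + |G| with hK
  have hK0 : 0 ≤ K := by
    have := Real.log_nonneg (by linarith : (1 : ℝ) ≤ q)
    positivity
  set R := 16 / β * K + P with hR
  have hR0 : 0 ≤ R := by positivity
  have hcpt : IsCompact ({y : Fin q → ℝ | sqNorm y ≤ R} ∩
      {y | ∀ j, δ ≤ sqNorm (y - peak a b j)}) := by
    refine (isCompact_sqNorm_le R).inter_right ?_
    rw [Set.ofPred_forall]
    exact isClosed_iInter fun j => isClosed_le continuous_const (by fun_prop)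
  obtain ⟨ε, hε, hmid⟩ : ∃ ε > 0, ∀ y ∈ ({y : Fin q → ℝ | sqNorm y ≤ R} ∩
      {y | ∀ j, δ ≤ sqNorm (y - peak a b j)}), G + ε ≤ freeEnergy β y := by
    rcases Set.eq_empty_or_nonempty ({y : Fin q → ℝ | sqNorm y ≤ R} ∩
      {y | ∀ j, δ ≤ sqNorm (y - peak a b j)}) with he | hne
    · exact ⟨1, one_pos, fun y hy => by rw [he] at hy; exact hy.elim⟩
    · obtain ⟨z, hz, hz'⟩ := hcpt.exists_isMinOn hne (continuous_freeEnergy β).continuousOn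
      refine ⟨freeEnergy β z - G, ?_, fun y hy => ?_⟩
      · refine sub_pos.2 (hgt z fun j hj => ?_)
        have := hz.2 j
        rw [hj, sub_self] at this
        simp [sqNorm] at this
        linarith
      · have : freeEnergy β z ≤ freeEnergy β y := hz' hy
        linarith
  set D := 2 * R + 2 * P + 1 with hD
  have hD0 : 0 < D := by positivity
  set c := min c₁ (min (ε / D) (β / 32)) with hc
  refine ⟨c, by positivity, fun y => ?_⟩
  have hcle : ∀ {c' s : ℝ}, c ≤ c' → 0 ≤ s → c * s ≤ c' * s := fun h1 h2 =>
    mul_le_mul_of_nonneg_right h1 h2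
  by_cases h1 : ∃ j, sqNorm (y - peak a b j) < δ
  · obtain ⟨j, hj⟩ := h1
    have := hloc j _ hj
    rw [add_sub_cancel, hGj] at this
    have h2 := hcle (min_le_left c₁ (min (ε / D) (β / 32))) (sqNorm_nonneg (y - peak a b j))
    exact ⟨j, by linarith⟩
  push Not at h1
  refine ⟨0, ?_⟩
  by_cases h2 : sqNorm y ≤ R
  · have h3 := hmid y ⟨h2, h1⟩
    have h4 := hcle ((min_le_right c₁ (min (ε / D) (β / 32))).trans (min_le_left _ _))
      (sqNorm_nonneg (y - peak a b 0))
    have h5 : ε / D * sqNorm (y - peak a b 0) ≤ ε := by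
      rw [div_mul_eq_mul_div, div_le_iff₀ hD0]
      refine mul_le_mul_of_nonneg_left ?_ hε.le
      linarith [hdist y]
    linarith
  · push Not at h2
    have h3 := freeEnergy_coercive hβ0 y
    have h4 := hcle ((min_le_right c₁ (min (ε / D) (β / 32))).trans (min_le_right _ _))
      (sqNorm_nonneg (y - peak a b 0))
    have h5 := hdist y
    have h6 : 16 * K + β * P < β * sqNorm y := by
      have : β * R = 16 * K + β * P := by rw [hR]; field_simp
      rw [← this]
      exact mul_lt_mul_of_pos_left h2 hβ0
    have h7 := le_abs_self G
    nlinarith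

lemma exp_neg_mul_sqNorm_eq_prod {q : ℕ} (t : ℝ) (y : Fin q → ℝ) :
    Real.exp (-t * sqNorm y) = ∏ i, Real.exp (-t * y i ^ 2) := by
  rw [← Real.exp_sum, sqNorm, Finset.mul_sum]

lemma integrable_exp_neg_mul_sqNorm {q : ℕ} {t : ℝ} (ht : 0 < t) (m : Fin q → ℝ) :
    MeasureTheory.Integrable (fun y : Fin q → ℝ => Real.exp (-t * sqNorm (y - m))) := by
  have : MeasureTheory.Integrable (fun y : Fin q → ℝ => Real.exp (-t * sqNorm y)) := by
    simp only [exp_neg_mul_sqNorm_eq_prod]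
    exact MeasureTheory.Integrable.fintype_prod (f := fun _ x => Real.exp (-t * x ^ 2))
      fun _ => integrable_exp_neg_mul_sq ht
  exact this.comp_sub_right m

lemma integral_exp_neg_mul_sqNorm {q : ℕ} (t : ℝ) (m : Fin q → ℝ) :
    ∫ y : Fin q → ℝ, Real.exp (-t * sqNorm (y - m)) = √(Real.pi / t) ^ q := by
  rw [MeasureTheory.integral_sub_right_eq_self (fun y : Fin q → ℝ => Real.exp (-t * sqNorm y)) m]
  simp only [exp_neg_mul_sqNorm_eq_prod]
  rw [MeasureTheory.integral_fintype_prod_volume_eq_prod (fun _ : Fin q => fun x : ℝ =>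
    Real.exp (-t * x ^ 2))]
  simp only [integral_gaussian, Finset.prod_const, Finset.card_univ, Fintype.card_fin]

lemma mul_exp_neg_le {t s : ℝ} (ht : 0 < t) :
    s * Real.exp (-t * s) ≤ 2 / t * Real.exp (-(t / 2) * s) := by
  have h1 : t / 2 * s ≤ Real.exp (t / 2 * s) := by linarith [Real.add_one_le_exp (t / 2 * s)]
  have h2 : Real.exp (-(t / 2) * s) = Real.exp (t / 2 * s) * Real.exp (-t * s) := by
    rw [← Real.exp_add]; congr 1; ring
  have h3 : s = 2 / t * (t / 2 * s) := by field_simp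
  rw [h2, ← mul_assoc]
  refine mul_le_mul_of_nonneg_right ?_ (Real.exp_pos _).le
  calc s = 2 / t * (t / 2 * s) := h3
    _ ≤ _ := mul_le_mul_of_nonneg_left h1 (by positivity)

lemma sum_comp_eq_sum_cntN {n q : ℕ} (σ : Conf n q) (g : Fin q → ℝ) :
    ∑ v, g (σ v) = ∑ j, (cntN σ j : ℝ) * g j := by
  rw [← Finset.sum_fiberwise (s := Finset.univ) (g := σ)]
  refine Finset.sum_congr rfl fun j _ => ?_
  rw [Finset.sum_congr rfl fun v hv => by rw [(Finset.mem_filter.1 hv).2],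
    Finset.sum_const, nsmul_eq_mul, cntN]

lemma sum_cntN_sq {n q : ℕ} (σ : Conf n q) :
    ∑ j, (cntN σ j : ℝ) ^ 2 = 2 * numMono σ + n := by
  have h1 : ∑ j, (cntN σ j : ℝ) ^ 2 = ∑ v, (cntN σ (σ v) : ℝ) := by
    rw [sum_comp_eq_sum_cntN σ fun j => (cntN σ j : ℝ)]
    simp only [sq]
  have h2 : ∑ v, (cntN σ (σ v) : ℝ) =
      ∑ p : Fin n × Fin n, if σ p.1 = σ p.2 then (1 : ℝ) else 0 := by
    rw [Fintype.sum_prod_type]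
    refine Finset.sum_congr rfl fun v _ => ?_
    rw [cntN, Finset.sum_boole]
    simp only [eq_comm]
  have h3 : ∀ p : Fin n × Fin n, (if σ p.1 = σ p.2 then (1 : ℝ) else 0) =
      (if p.1 < p.2 ∧ σ p.1 = σ p.2 then 1 else 0) +
      (if p.2 < p.1 ∧ σ p.2 = σ p.1 then 1 else 0) + if p.1 = p.2 then 1 else 0 := by
    rintro ⟨u, v⟩
    rcases lt_trichotomy u v with h | rfl | h
    · simp [h, h.ne, h.not_gt]
    · simp
    · simp [h, h.ne', h.not_gt, eq_comm]
  have h4 : ∑ p : Fin n × Fin n, (if p.2 < p.1 ∧ σ p.2 = σ p.1 then (1 : ℝ) else 0) =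
      ∑ p : Fin n × Fin n, (if p.1 < p.2 ∧ σ p.1 = σ p.2 then (1 : ℝ) else 0) :=
    (Equiv.prodComm (Fin n) (Fin n)).sum_comp
      fun p => if p.1 < p.2 ∧ σ p.1 = σ p.2 then (1 : ℝ) else 0
  have h5 : ∑ p : Fin n × Fin n, (if p.1 = p.2 then (1 : ℝ) else 0) = n := by
    rw [Fintype.sum_prod_type]; simp
  have h6 : ∑ p : Fin n × Fin n, (if p.1 < p.2 ∧ σ p.1 = σ p.2 then (1 : ℝ) else 0) =
      numMono σ := by
    rw [Finset.sum_boole, numMono]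
  rw [h1, h2]
  simp only [h3, Finset.sum_add_distrib, h4, h5, h6]
  ring

/-- The Gibbs weight of a configuration, as a function of its proportions. -/
noncomputable def gibbsWeight {n q : ℕ} (β : ℝ) (σ : Conf n q) : ℝ :=
  Real.exp (β * n / 2 * sqNorm (cntFrac σ))

lemma exp_numMono_eq {n q : ℕ} (hn : 0 < n) (β : ℝ) (σ : Conf n q) :
    Real.exp (β / n * numMono σ) = Real.exp (-(β / 2)) * gibbsWeight β σ := by
  have hn' : (0 : ℝ) < n := by exact_mod_cast hn
  have h := sum_cntN_sq σ
  have h2 : sqNorm (cntFrac σ) = (2 * numMono σ + n) / (n : ℝ) ^ 2 := by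
    rw [← h, Finset.sum_div]
    simp only [sqNorm, cntFrac, div_pow]
  rw [gibbsWeight, ← Real.exp_add, h2]
  congr 1
  field_simp
  ring

lemma pottsProb_eq {n q : ℕ} (hn : 0 < n) (β : ℝ) (σ : Conf n q) :
    pottsProb n q β σ = gibbsWeight β σ / ∑ τ : Conf n q, gibbsWeight β τ := by
  rw [pottsProb]
  simp only [exp_numMono_eq hn, ← Finset.mul_sum]
  rw [mul_div_mul_left _ _ (Real.exp_pos _).ne']

/-- Gaussian linearization: summing the tilted Gibbs weights gives the free energy. -/
lemma sum_gibbsWeight_mul_exp {n q : ℕ} [NeZero q] (hn : 0 < n) (β : ℝ) (y : Fin q → ℝ) :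
    ∑ σ : Conf n q, gibbsWeight β σ * Real.exp (-(β * n / 2) * sqNorm (y - cntFrac σ)) =
      Real.exp (-(n * freeEnergy β y)) := by
  have hn' : (0 : ℝ) < n := by exact_mod_cast hn
  have h1 : ∀ σ : Conf n q,
      gibbsWeight β σ * Real.exp (-(β * n / 2) * sqNorm (y - cntFrac σ)) =
        Real.exp (-(n * (β / 2 * sqNorm y))) * ∏ v, Real.exp (β * y (σ v)) := by
    intro σ
    have h2 : sqNorm (y - cntFrac σ) = sqNorm y - 2 * (∑ v, y (σ v)) / n
        + sqNorm (cntFrac σ) := by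
      have : ∀ i, (y - cntFrac σ) i ^ 2 =
          y i ^ 2 - 2 / n * (cntN σ i * y i) + cntFrac σ i ^ 2 := by
        intro i; rw [Pi.sub_apply, cntFrac]; ring
      simp only [sqNorm, this, Finset.sum_add_distrib, Finset.sum_sub_distrib, ← Finset.mul_sum,
        sum_comp_eq_sum_cntN σ y]
      ring
    rw [gibbsWeight, ← Real.exp_sum, ← Finset.mul_sum, ← Real.exp_add, ← Real.exp_add, h2]
    congr 1
    field_simp
    ring
  simp only [h1, ← Finset.mul_sum]
  rw [← Fintype.sum_pow (fun j => Real.exp (β * y j)), freeEnergy,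
    ← Real.exp_log (sum_exp_pos β y), ← Real.exp_nat_mul, ← Real.exp_add, Real.log_exp]
  congr 1
  ring

lemma exp_neg_freeEnergy_le {n q : ℕ} [NeZero q] (hn : 0 < n) {β : ℝ} (hβ : 0 < β)
    (y : Fin q → ℝ) :
    Real.exp (-(n * freeEnergy β y)) ≤ ∑ σ : Conf n q, gibbsWeight β σ := by
  rw [← sum_gibbsWeight_mul_exp hn]
  refine Finset.sum_le_sum fun σ _ => mul_le_of_le_one_right (Real.exp_pos _).le ?_
  rw [Real.exp_le_one_iff]
  have := sqNorm_nonneg (y - cntFrac σ)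
  have : 0 ≤ β * n / 2 * sqNorm (y - cntFrac σ) := by positivity
  linarith

/-- The total weight of configurations whose proportions are at squared distance more than `r / n`
from all peaks is at most a constant over `r` times the partition function. -/
lemma IsMeanFieldPair.far_weight_le {q : ℕ} [NeZero q] {β a b : ℝ} (hq : 2 ≤ q)
    (hβ : (q : ℝ) < β) (h : IsMeanFieldPair q β a b) :
    ∃ C > 0, ∀ n : ℕ, 0 < n → ∀ r : ℝ, 0 < r →
      ∑ σ : Conf n q with ∀ j, r / n < sqNorm (cntFrac σ - peak a b j), gibbsWeight β σ ≤
        C / r * ∑ σ : Conf n q, gibbsWeight β σ := by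
  have hβ0 : 0 < β := lt_of_le_of_lt (Nat.cast_nonneg q) hβ
  obtain ⟨c, hc, hgrow⟩ := h.global_growth hq hβ
  set G := freeEnergy β (peak a b (0 : Fin q)) with hG
  have hpi := Real.pi_pos
  have hq0 : (0 : ℝ) < q := by exact_mod_cast Nat.pos_of_neZero q
  refine ⟨2 * (4 / β * √(Real.pi / (β / 4)) ^ q + q * (2 / c * √(Real.pi / (c / 2)) ^ q)) /
    √(Real.pi / (β / 2)) ^ q, by positivity, fun n hn r hr => ?_⟩
  have hn' : (0 : ℝ) < n := by exact_mod_cast hn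
  set Z := ∑ σ : Conf n q, gibbsWeight β σ with hZ
  set B := Finset.univ.filter
    (fun σ : Conf n q => ∀ j, r / n < sqNorm (cntFrac σ - peak a b j)) with hB
  have hpt : ∀ y : Fin q → ℝ,
      ∑ σ ∈ B, gibbsWeight β σ * Real.exp (-(β * n / 2) * sqNorm (y - cntFrac σ)) ≤
      2 * n / r * (∑ σ : Conf n q, gibbsWeight β σ *
          (2 / (β * n / 2) * Real.exp (-(β * n / 2 / 2) * sqNorm (y - cntFrac σ))) +
        ∑ j : Fin q, Real.exp (-(n * G)) *
          (2 / (n * c) * Real.exp (-(n * c / 2) * sqNorm (y - peak a b j)))) := by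
    intro y
    obtain ⟨j, hj⟩ := hgrow y
    have hd0 := sqNorm_nonneg (y - peak a b j)
    set d := sqNorm (y - peak a b j) with hd
    have h1 : ∀ σ ∈ B, gibbsWeight β σ * Real.exp (-(β * n / 2) * sqNorm (y - cntFrac σ)) ≤
        2 * n / r * ((sqNorm (y - cntFrac σ) + d) *
          (gibbsWeight β σ * Real.exp (-(β * n / 2) * sqNorm (y - cntFrac σ)))) := by
      intro σ hσ
      have h2 := (Finset.mem_filter.1 hσ).2 j
      have h3 := sqNorm_add_le (cntFrac σ - y) (y - peak a b j)
      rw [sub_add_sub_cancel] at h3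
      have h4 : sqNorm (cntFrac σ - y) = sqNorm (y - cntFrac σ) :=
        Finset.sum_congr rfl fun i _ => by simp only [Pi.sub_apply]; ring
      rw [h4] at h3
      have h5 : 1 ≤ 2 * n / r * (sqNorm (y - cntFrac σ) + d) := by
        have h6 := h2.trans_le h3
        rw [div_lt_iff₀ hn'] at h6
        rw [div_mul_eq_mul_div, one_le_div hr]
        linarith
      rw [← mul_assoc]
      exact le_mul_of_one_le_left (mul_pos (Real.exp_pos _) (Real.exp_pos _)).le h5
    refine (Finset.sum_le_sum h1).trans ?_
    rw [← Finset.mul_sum]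
    refine mul_le_mul_of_nonneg_left ?_ (by positivity)
    have h2 : ∑ σ ∈ B, (sqNorm (y - cntFrac σ) + d) *
          (gibbsWeight β σ * Real.exp (-(β * n / 2) * sqNorm (y - cntFrac σ))) ≤
        ∑ σ : Conf n q, (sqNorm (y - cntFrac σ) + d) *
          (gibbsWeight β σ * Real.exp (-(β * n / 2) * sqNorm (y - cntFrac σ))) :=
      Finset.sum_le_sum_of_subset_of_nonneg (Finset.subset_univ _) fun σ _ _ =>
        mul_nonneg (add_nonneg (sqNorm_nonneg _) hd0)
          (mul_pos (Real.exp_pos _) (Real.exp_pos _)).le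
    refine h2.trans ?_
    simp only [add_mul, Finset.sum_add_distrib]
    refine add_le_add (Finset.sum_le_sum fun σ _ => ?_) ?_
    · rw [mul_left_comm]
      exact mul_le_mul_of_nonneg_left (mul_exp_neg_le (by positivity)) (Real.exp_pos _).le
    · rw [← Finset.mul_sum, sum_gibbsWeight_mul_exp hn]
      refine le_trans ?_ (Finset.single_le_sum (f := fun j : Fin q => Real.exp (-(n * G)) *
        (2 / (n * c) * Real.exp (-(n * c / 2) * sqNorm (y - peak a b j))))
        (fun _ _ => by positivity) (Finset.mem_univ j))
      have h3 : Real.exp (-(n * freeEnergy β y)) ≤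
          Real.exp (-(n * G)) * Real.exp (-(n * c) * d) := by
        rw [← Real.exp_add]
        refine Real.exp_le_exp.2 ?_
        nlinarith [mul_le_mul_of_nonneg_left hj hn'.le]
      calc d * Real.exp (-(n * freeEnergy β y))
          ≤ d * (Real.exp (-(n * G)) * Real.exp (-(n * c) * d)) :=
            mul_le_mul_of_nonneg_left h3 hd0
        _ = Real.exp (-(n * G)) * (d * Real.exp (-(n * c) * d)) := by ring
        _ ≤ _ := mul_le_mul_of_nonneg_left (mul_exp_neg_le (by positivity)) (Real.exp_pos _).le
  have i1 : ∀ σ ∈ B, MeasureTheory.Integrable (fun y : Fin q → ℝ =>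
      gibbsWeight β σ * Real.exp (-(β * n / 2) * sqNorm (y - cntFrac σ))) := fun σ _ =>
    (integrable_exp_neg_mul_sqNorm (by positivity) _).const_mul _
  have i2 : ∀ σ ∈ (Finset.univ : Finset (Conf n q)), MeasureTheory.Integrable
      (fun y : Fin q → ℝ => gibbsWeight β σ *
          (2 / (β * n / 2) * Real.exp (-(β * n / 2 / 2) * sqNorm (y - cntFrac σ)))) := fun σ _ =>
    ((integrable_exp_neg_mul_sqNorm (by positivity) _).const_mul _).const_mul _
  have i3 : ∀ j ∈ (Finset.univ : Finset (Fin q)), MeasureTheory.Integrable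
      (fun y : Fin q → ℝ => Real.exp (-(n * G)) *
          (2 / (n * c) * Real.exp (-(n * c / 2) * sqNorm (y - peak a b j)))) := fun j _ =>
    ((integrable_exp_neg_mul_sqNorm (by positivity) _).const_mul _).const_mul _
  have hint := MeasureTheory.integral_mono (MeasureTheory.integrable_finsetSum _ i1)
    (((MeasureTheory.integrable_finsetSum _ i2).add
      (MeasureTheory.integrable_finsetSum _ i3)).const_mul (2 * n / r)) hpt
  rw [MeasureTheory.integral_finsetSum _ i1, MeasureTheory.integral_const_mul] at hint
  simp only [Pi.add_apply] at hint
  rw [MeasureTheory.integral_add (MeasureTheory.integrable_finsetSum _ i2)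
      (MeasureTheory.integrable_finsetSum _ i3), MeasureTheory.integral_finsetSum _ i2,
    MeasureTheory.integral_finsetSum _ i3] at hint
  simp only [MeasureTheory.integral_const_mul, integral_exp_neg_mul_sqNorm, ← Finset.sum_mul,
    Finset.sum_const, Finset.card_univ, Fintype.card_fin, nsmul_eq_mul, ← hZ] at hint
  have hscale : ∀ t : ℝ, √(Real.pi / (t * n)) ^ q = √(Real.pi / t) ^ q * (1 / √n) ^ q := by
    intro t
    rw [← div_div, Real.sqrt_div' _ hn'.le, ← mul_pow, mul_one_div]
  rw [show β * n / 2 = β / 2 * n by ring, show β / 2 * n / 2 = β / 4 * n by ring,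
    show n * c / 2 = c / 2 * n by ring, hscale, hscale, hscale] at hint
  set s := (1 / √(n : ℝ)) ^ q with hs
  have hs0 : 0 < s := by positivity
  have hGZ : Real.exp (-(n * G)) ≤ Z := exp_neg_freeEnergy_le hn hβ0 _
  have hI0 : 0 < √(Real.pi / (β / 2)) ^ q := by positivity
  set I₀ := √(Real.pi / (β / 2)) ^ q
  set I₁ := √(Real.pi / (β / 4)) ^ q
  set I₂ := √(Real.pi / (c / 2)) ^ q
  have hI2 : 0 ≤ I₂ := by positivity
  have hfin : (∑ σ ∈ B, gibbsWeight β σ) * (I₀ * s) ≤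
      2 * (4 / β * I₁ + q * (2 / c * I₂)) / I₀ / r * Z * (I₀ * s) := by
    calc _ ≤ _ := hint
      _ ≤ 2 * n / r * (Z * (2 / (β / 2 * n) * (I₁ * s)) +
          q * Z * (2 / (n * c) * (I₂ * s))) := by gcongr
      _ = _ := by field_simp; ring
  exact le_of_mul_le_mul_right hfin (by positivity)

lemma linf_alphaVec_le {n q : ℕ} [NeZero q] {a b ε : ℝ} (hab : b ≤ a)
    (X : Conf n q) (j : Fin q) (h : ∀ i, |cntFrac X i - peak a b j i| ≤ ε) :
    linf (alphaVec X) (fun i : Fin q => if (i : ℕ) = 0 then a else b) ≤ ε := by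
  set f := cntFrac X with hf
  have hj : |f j - a| ≤ ε := by simpa [peak] using h j
  have hne : ∀ i, i ≠ j → |f i - b| ≤ ε := fun i hi => by simpa [peak, hi] using h i
  have hmax : ∀ i, f i ≤ alphaVec X 0 := by
    intro i
    have hmono := Tuple.monotone_sort f
    have := hmono (show (Tuple.sort f).symm i ≤ (0 : Fin q).rev by
      rw [Fin.le_def, Fin.val_rev]
      have := ((Tuple.sort f).symm i).isLt
      simp only [Fin.val_zero]
      omega)
    simpa [alphaVec, ← hf] using this
  refine ciSup_le fun i => ?_
  obtain ⟨l, hl⟩ : ∃ l, Tuple.sort f i.rev = l := ⟨_, rfl⟩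
  obtain ⟨l₀, hl₀⟩ : ∃ l₀, Tuple.sort f (0 : Fin q).rev = l₀ := ⟨_, rfl⟩
  have e : alphaVec X i = f l := by rw [alphaVec, ← hf, hl]
  have e₀ : alphaVec X 0 = f l₀ := by rw [alphaVec, ← hf, hl₀]
  have hjm := hmax j
  rw [e₀] at hjm
  rw [abs_le] at hj
  by_cases hi : i = 0
  · subst hi
    have : l = l₀ := hl.symm.trans hl₀
    subst this
    simp only [Fin.val_zero, if_true, e]
    by_cases hlj : l = j
    · subst hlj; exact abs_le.2 hj
    · have := abs_le.1 (hne l hlj)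
      rw [abs_le]
      constructor <;> linarith
  · have hi' : (i : ℕ) ≠ 0 := fun h0 => hi (Fin.ext h0)
    simp only [hi', if_false, e]
    by_cases hlj : l = j
    · have hl₀j : l₀ ≠ j := by
        rintro rfl
        have := (Tuple.sort f).injective (hl.trans (hlj.trans hl₀.symm))
        exact hi (Fin.rev_injective this)
      have := abs_le.1 (hne l₀ hl₀j)
      rw [hlj, abs_le]
      constructor <;> linarith
    · exact hne l hlj

lemma IsMeanFieldPair.mVec_eq {q : ℕ} {β a b : ℝ} (hq : 2 ≤ q) (hβ : (q : ℝ) < β)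
    (h : IsMeanFieldPair q β a b) :
    mVec q β = fun i : Fin q => if (i : ℕ) = 0 then a else b := by
  have hq2 : (2 : ℝ) ≤ q := by exact_mod_cast hq
  have hb : (1 - a) / ((q : ℝ) - 1) = b := by
    rw [div_eq_iff (by linarith)]
    linarith [h.sum_eq]
  ext i
  rw [mVec, kappaVec, h.aFix_eq hq hβ, hb]

/-- Lemma 4.3: under the stationary mean-field Potts measure,
the proportions vector is within `A/√n` of `m` with probability at least `3/4`. -/
theorem potts_concentration (q : ℕ) (hq : 2 ≤ q) (β : ℝ) (hβ : (q : ℝ) < β) :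
    ∃ A : ℝ, 0 < A ∧ ∃ N : ℕ, ∀ n : ℕ, N ≤ n →
      (3 : ℝ) / 4 ≤ ∑ τ : Conf n q,
        (if linf (alphaVec τ) (mVec q β) ≤ A / Real.sqrt n
          then pottsProb n q β τ else 0) := by
  have : NeZero q := ⟨by omega⟩
  obtain ⟨a, b, h⟩ := exists_isMeanFieldPair hq hβ
  obtain ⟨C, hC, hfar⟩ := h.far_weight_le hq hβ
  refine ⟨√(4 * C), by positivity, 1, fun n hn => ?_⟩
  have hn' : (0 : ℝ) < n := by exact_mod_cast hn
  have hbad := hfar n hn (4 * C) (by positivity)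
  set Z := ∑ σ : Conf n q, gibbsWeight β σ with hZ
  have hZ0 : 0 < Z := Finset.sum_pos (fun _ _ => Real.exp_pos _) Finset.univ_nonempty
  have hgood : ∀ τ : Conf n q, gibbsWeight β τ / Z -
      (if ∀ j, 4 * C / n < sqNorm (cntFrac τ - peak a b j) then gibbsWeight β τ / Z else 0) ≤
      if linf (alphaVec τ) (mVec q β) ≤ √(4 * C) / √n then pottsProb n q β τ else 0 := by
    intro τ
    have hp : 0 ≤ gibbsWeight β τ / Z := div_nonneg (Real.exp_pos _).le hZ0.le
    rw [pottsProb_eq hn, ← hZ]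
    by_cases hτ : ∀ j, 4 * C / n < sqNorm (cntFrac τ - peak a b j)
    · rw [if_pos hτ, sub_self]
      split_ifs
      · exact hp
      · exact le_rfl
    · rw [if_neg hτ, sub_zero]
      push Not at hτ
      obtain ⟨j, hj⟩ := hτ
      rw [if_pos]
      rw [h.mVec_eq hq hβ]
      refine linf_alphaVec_le h.lt.le τ j fun i => ?_
      rw [← Real.sqrt_div' _ hn'.le]
      exact Real.abs_le_sqrt ((sq_le_sqNorm (cntFrac τ - peak a b j) i).trans hj)
  refine le_trans ?_ (Finset.sum_le_sum fun τ _ => hgood τ)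
  rw [Finset.sum_sub_distrib, ← Finset.sum_div, ← hZ, div_self hZ0.ne', ← Finset.sum_filter,
    ← Finset.sum_div]
  have : (∑ σ : Conf n q with ∀ j, 4 * C / n < sqNorm (cntFrac σ - peak a b j),
      gibbsWeight β σ) / Z ≤ 1 / 4 := by
    rw [div_le_iff₀ hZ0]
    refine hbad.trans_eq ?_
    field_simp
  linarith
end

section
/- Let q ≥ 2 be an integer and β > q. Then the drift function F has a unique fixed point a = a(β,q) in the interval (1/q, 1], and |F′(a)| < 1. -/
open scoped Classical
open Finset

theorem exp_neg_mul_eq_one_sub_unique {lam s t : ℝ} (hs : s ∈ Set.Ioo (0 : ℝ) 1)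
    (ht : t ∈ Set.Ioo (0 : ℝ) 1) (hes : Real.exp (-lam * s) = 1 - s)
    (het : Real.exp (-lam * t) = 1 - t) : s = t := by
  have key : ∀ u v : ℝ, 0 < u → u < v → Real.exp (-lam * u) = 1 - u →
      Real.exp (-lam * v) = 1 - v → False := by
    intro u v hu huv heu hev
    have hv : 0 < v := hu.trans huv
    have hne : -lam * v ≠ 0 := by
      intro h
      rw [h, Real.exp_zero] at hev
      linarith
    have h := strictConvexOn_exp.2 (Set.mem_univ (-lam * v)) (Set.mem_univ 0) hne
      (show 0 < u / v by positivity)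
      (show 0 < 1 - u / v by rw [sub_pos, div_lt_one hv]; exact huv) (by ring)
    have h1 : u / v * (-lam * v) = -lam * u := by field_simp
    have h2 : u / v * (1 - v) = u / v - u := by field_simp
    simp only [smul_eq_mul, mul_zero, add_zero, Real.exp_zero, mul_one, h1, heu, hev, h2] at h
    linarith
  rcases lt_trichotomy s t with h | h | h
  · exact (key s t hs.1 h hes het).elim
  · exact h
  · exact (key t s ht.1 h het hes).elim

theorem theta_eq_of_exp {lam t : ℝ} (hlam : 1 < lam) (ht : t ∈ Set.Ioo (0 : ℝ) 1)
    (he : Real.exp (-lam * t) = 1 - t) : theta lam = t := by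
  have hset : {x : ℝ | x ∈ Set.Ioo (0 : ℝ) 1 ∧ Real.exp (-lam * x) = 1 - x} = {t} := by
    ext x
    constructor
    · rintro ⟨hx, hex⟩
      exact exp_neg_mul_eq_one_sub_unique hx ht hex he
    · rintro rfl
      exact ⟨ht, he⟩
  rw [theta, if_neg hlam.not_ge, hset, csSup_singleton]

theorem theta_spec {lam : ℝ} (hlam : 1 < lam) :
    theta lam ∈ Set.Ioo (0 : ℝ) 1 ∧ Real.exp (-lam * theta lam) = 1 - theta lam := by
  have h0 : 0 < lam := by linarith
  set c : ℝ := (lam - 1) / (2 * lam) with hc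
  have hc0 : 0 < c := div_pos (by linarith) (by linarith)
  have hc1 : c < 1 := by rw [hc, div_lt_one (by linarith)]; linarith
  have hlc : lam * c = (lam - 1) / 2 := by rw [hc]; field_simp
  have hneg : Real.exp (-lam * c) - (1 - c) < 0 := by
    have h1 : 1 + lam * c ≤ Real.exp (lam * c) := by
      linarith [Real.add_one_le_exp (lam * c)]
    have h2 : Real.exp (-lam * c) * Real.exp (lam * c) = 1 := by
      rw [← Real.exp_add]; simp
    have h3 : 0 < Real.exp (-lam * c) := Real.exp_pos _
    have h4 : 1 < (1 + lam * c) * (1 - c) := by nlinarith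
    have h5 : Real.exp (-lam * c) * (1 + lam * c) ≤ 1 := by nlinarith
    nlinarith
  have hpos : 0 < Real.exp (-lam * 1) - (1 - 1) := by
    linarith [Real.exp_pos (-lam * 1)]
  obtain ⟨x, hx, hfx⟩ := intermediate_value_Ioo hc1.le
    (f := fun x : ℝ => Real.exp (-lam * x) - (1 - x)) (by fun_prop) ⟨hneg, hpos⟩
  have hx' : x ∈ Set.Ioo (0 : ℝ) 1 := ⟨hc0.trans hx.1, hx.2⟩
  have he : Real.exp (-lam * x) = 1 - x := sub_eq_zero.mp hfx
  rw [theta_eq_of_exp hlam hx' he]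
  exact ⟨hx', he⟩

/-- Its zeros `t` in `(0,1)` are the values `theta (β * x)` at the fixed points `x` of the drift
function. -/
noncomputable def driftAux (q β t : ℝ) : ℝ :=
  -Real.log (1 - t) - β * t / (q - (q - 1) * t)

/-- The numerator of the derivative of `driftAux`. -/
noncomputable def driftAuxNum (q β t : ℝ) : ℝ :=
  (q - (q - 1) * t) ^ 2 - β * q * (1 - t)

theorem driftAux_zero (q β : ℝ) : driftAux q β 0 = 0 := by
  simp [driftAux]

theorem one_lt_driftAux_denom {q t : ℝ} (hq : 1 < q) (ht : t < 1) : 1 < q - (q - 1) * t := by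
  nlinarith

theorem hasDerivAt_driftAux {q β t : ℝ} (hq : 1 < q) (ht : t < 1) :
    HasDerivAt (driftAux q β)
      (driftAuxNum q β t / ((1 - t) * (q - (q - 1) * t) ^ 2)) t := by
  have h1 : 1 - t ≠ 0 := by linarith
  have h2 : q - (q - 1) * t ≠ 0 := by linarith [one_lt_driftAux_denom hq ht]
  have hlog := (((hasDerivAt_id t).const_sub 1).log h1).neg
  have hfrac := ((hasDerivAt_id t).const_mul β).div
    (((hasDerivAt_id t).const_mul (q - 1)).const_sub q) h2
  refine (hlog.sub hfrac).congr_deriv ?_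
  have hnum : β * 1 * (q - (q - 1) * t) - β * t * -((q - 1) * 1) = β * q := by ring
  simp only [id, driftAuxNum, hnum]
  generalize q - (q - 1) * t = D at h2 ⊢
  field_simp

theorem continuousOn_driftAux {q β : ℝ} (hq : 1 < q) :
    ContinuousOn (driftAux q β) (Set.Iio 1) := fun _ ht =>
  (hasDerivAt_driftAux hq ht).continuousAt.continuousWithinAt

theorem driftAuxNum_chord (q β u t : ℝ) :
    t * driftAuxNum q β u = u * driftAuxNum q β t + (t - u) * (q * (q - β))
      - (q - 1) ^ 2 * (u * t * (t - u)) := by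
  unfold driftAuxNum
  ring

theorem driftAuxNum_pos_of_zero {q β t : ℝ} (hq : 1 < q) (hβ : q < β)
    (ht : t ∈ Set.Ioo (0 : ℝ) 1) (hz : driftAux q β t = 0) : 0 < driftAuxNum q β t := by
  by_contra! hN
  have hanti : StrictAntiOn (driftAux q β) (Set.Icc 0 t) := by
    refine strictAntiOn_of_deriv_neg (convex_Icc 0 t)
      ((continuousOn_driftAux hq).mono fun u hu => hu.2.trans_lt ht.2) fun u hu => ?_
    rw [interior_Icc] at hu
    have hu1 : u < 1 := hu.2.trans ht.2
    have hD := one_lt_driftAux_denom hq hu1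
    rw [(hasDerivAt_driftAux hq hu1).deriv]
    refine div_neg_of_neg_of_pos ?_ (mul_pos (by linarith) (by positivity))
    have hchord := driftAuxNum_chord q β u t
    have h1 : u * driftAuxNum q β t ≤ 0 := mul_nonpos_of_nonneg_of_nonpos hu.1.le hN
    have h2 : (t - u) * (q * (q - β)) < 0 :=
      mul_neg_of_pos_of_neg (sub_pos.2 hu.2)
        (mul_neg_of_pos_of_neg (by linarith) (by linarith))
    have h3 : 0 ≤ (q - 1) ^ 2 * (u * t * (t - u)) :=
      mul_nonneg (sq_nonneg _)
        (mul_nonneg (mul_nonneg hu.1.le ht.1.le) (sub_nonneg.2 hu.2.le))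
    by_contra! h
    linarith [mul_nonneg ht.1.le h]
  have := hanti (Set.left_mem_Icc.2 ht.1.le) (Set.right_mem_Icc.2 ht.1.le) ht.1
  rw [hz, driftAux_zero] at this
  exact lt_irrefl _ this

theorem driftAux_zero_unique {q β s t : ℝ} (hq : 1 < q) (hβ : q < β)
    (hs : s ∈ Set.Ioo (0 : ℝ) 1) (ht : t ∈ Set.Ioo (0 : ℝ) 1)
    (hzs : driftAux q β s = 0) (hzt : driftAux q β t = 0) : s = t := by
  wlog hst : s ≤ t generalizing s t
  · exact (this ht hs hzt hzs (le_of_not_ge hst)).symm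
  by_contra hne
  have hlt : s < t := lt_of_le_of_ne hst hne
  have hN := driftAuxNum_pos_of_zero hq hβ hs hzs
  have hmono : StrictMonoOn (driftAux q β) (Set.Icc s t) := by
    refine strictMonoOn_of_deriv_pos (convex_Icc s t)
      ((continuousOn_driftAux hq).mono fun u hu => hu.2.trans_lt ht.2) fun u hu => ?_
    rw [interior_Icc] at hu
    have hu1 : u < 1 := hu.2.trans ht.2
    have hu0 : 0 < u := hs.1.trans hu.1
    have hD := one_lt_driftAux_denom hq hu1
    rw [(hasDerivAt_driftAux hq hu1).deriv]
    refine div_pos ?_ (mul_pos (by linarith) (by positivity))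
    have hchord := driftAuxNum_chord q β s u
    have h1 : 0 < u * driftAuxNum q β s := mul_pos hu0 hN
    have h2 : (u - s) * (q * (q - β)) < 0 :=
      mul_neg_of_pos_of_neg (sub_pos.2 hu.1)
        (mul_neg_of_pos_of_neg (by linarith) (by linarith))
    have h3 : 0 ≤ (q - 1) ^ 2 * (s * u * (u - s)) :=
      mul_nonneg (sq_nonneg _)
        (mul_nonneg (mul_nonneg hs.1.le hu0.le) (sub_nonneg.2 hu.1.le))
    exact pos_of_mul_pos_right (show 0 < s * driftAuxNum q β u by linarith) hs.1.le
  have := hmono (Set.left_mem_Icc.2 hst) (Set.right_mem_Icc.2 hst) hlt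
  rw [hzs, hzt] at this
  exact lt_irrefl _ this

theorem exists_driftAux_zero {q β : ℝ} (hq : 1 < q) (hβ : q < β) :
    ∃ t ∈ Set.Ioo (0 : ℝ) 1, driftAux q β t = 0 := by
  set a : ℝ := (β - q) / (β - q + 2) with ha
  have hden : 0 < β - q + 2 := by linarith
  have ha0 : 0 < a := div_pos (by linarith) hden
  have ha1 : a < 1 := by rw [ha, div_lt_one hden]; linarith
  have hamul : a * (β - q + 2) = β - q := by rw [ha]; field_simp
  have haneg : driftAux q β a ≤ 0 := by
    have hD := one_lt_driftAux_denom hq ha1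
    have h1 := Real.one_sub_inv_le_log_of_pos (sub_pos.2 ha1)
    have h2 : (1 - a)⁻¹ - 1 = a / (1 - a) := by
      have : 1 - a ≠ 0 := by linarith
      field_simp
      ring
    have h3 : a / (1 - a) ≤ β * a / (q - (q - 1) * a) := by
      rw [div_le_div_iff₀ (by linarith) (by linarith)]
      nlinarith [mul_pos ha0 ha0]
    unfold driftAux
    linarith
  set b : ℝ := 1 - Real.exp (-(β + 1)) with hb
  have hb1 : b < 1 := by linarith [Real.exp_pos (-(β + 1))]
  have hb0 : 0 < b := by
    have : Real.exp (-(β + 1)) < 1 := by rw [Real.exp_lt_one_iff]; linarith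
    linarith
  have hbpos : 0 ≤ driftAux q β b := by
    have hD := one_lt_driftAux_denom hq hb1
    have h1 : Real.log (1 - b) = -(β + 1) := by
      rw [hb, sub_sub_cancel, Real.log_exp]
    have h2 : β * b / (q - (q - 1) * b) ≤ β := by
      rw [div_le_iff₀ (by linarith)]
      have : 0 < β := by linarith
      exact mul_le_mul_of_nonneg_left (hb1.trans hD).le this.le
    unfold driftAux
    rw [h1]
    linarith
  exact isPreconnected_Ioo.intermediate_value (f := driftAux q β) ⟨ha0, ha1⟩ ⟨hb0, hb1⟩
    ((continuousOn_driftAux hq).mono fun u hu => hu.2) ⟨haneg, hbpos⟩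

theorem one_lt_mul_of_inv_lt {q β x : ℝ} (hq : 1 < q) (hβ : q < β) (hx : 1 / q < x) :
    1 < β * x := by
  rw [div_lt_iff₀ (by linarith)] at hx
  have : 0 < x := by
    by_contra! h
    nlinarith
  nlinarith

theorem mul_denom_eq_one_of_fixed {q : ℕ} {β x : ℝ} (hq : (1 : ℝ) < q) (hfix : F q β x = x) :
    x * ((q : ℝ) - (q - 1) * theta (β * x)) = 1 := by
  have hq0 : (q : ℝ) ≠ 0 := by linarith
  unfold F at hfix
  field_simp at hfix
  linear_combination -hfix

theorem driftAux_theta_of_fixed {q : ℕ} {β x : ℝ} (hq : (1 : ℝ) < q) (hβ : (q : ℝ) < β)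
    (hx : 1 / (q : ℝ) < x) (hfix : F q β x = x) : driftAux q β (theta (β * x)) = 0 := by
  obtain ⟨ht, he⟩ := theta_spec (one_lt_mul_of_inv_lt hq hβ hx)
  have hD := one_lt_driftAux_denom hq ht.2
  have hxD := mul_denom_eq_one_of_fixed hq hfix
  have hx' : β * theta (β * x) / ((q : ℝ) - (q - 1) * theta (β * x))
      = β * x * theta (β * x) := by
    rw [div_eq_iff (by linarith)]
    linear_combination -(β * theta (β * x)) * hxD
  rw [driftAux, hx', ← he, Real.log_exp]
  ring

theorem fixed_of_driftAux_zero {q : ℕ} {β t : ℝ} (hq : (1 : ℝ) < q) (hβ : (q : ℝ) < β)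
    (ht : t ∈ Set.Ioo (0 : ℝ) 1) (hz : driftAux q β t = 0) :
    ((q : ℝ) - (q - 1) * t)⁻¹ ∈ Set.Ioc (1 / (q : ℝ)) 1 ∧
      F q β ((q : ℝ) - (q - 1) * t)⁻¹ = ((q : ℝ) - (q - 1) * t)⁻¹ := by
  have hD := one_lt_driftAux_denom hq ht.2
  have hlow : 1 / (q : ℝ) < ((q : ℝ) - (q - 1) * t)⁻¹ := by
    rw [one_div]
    refine inv_strictAnti₀ (by linarith) ?_
    linarith [mul_pos (sub_pos.2 hq) ht.1]
  have he : Real.exp (-(β * ((q : ℝ) - (q - 1) * t)⁻¹) * t) = 1 - t := by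
    rw [← Real.exp_log (sub_pos.2 ht.2)]
    congr 1
    unfold driftAux at hz
    rw [div_eq_mul_inv] at hz
    linear_combination hz
  refine ⟨⟨hlow, inv_le_one_of_one_le₀ hD.le⟩, ?_⟩
  rw [F, theta_eq_of_exp (one_lt_mul_of_inv_lt hq hβ hlow) ht he]
  have hD0 : (q : ℝ) - (q - 1) * t ≠ 0 := by linarith
  have hq0 : (q : ℝ) ≠ 0 := by linarith
  field_simp
  ring

/-- Implicit differentiation of the equation defining `theta`. -/
theorem deriv_F_mul {q : ℕ} {β x : ℝ} (hq : (1 : ℝ) < q) (hβ : (q : ℝ) < β)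
    (hx : 1 / (q : ℝ) < x) (hd : DifferentiableAt ℝ (F q β) x) :
    deriv (F q β) x * (1 - (1 - theta (β * x)) * (β * x))
      = (1 - 1 / (q : ℝ)) * theta (β * x) := by
  have hq0 : (q : ℝ) ≠ 0 := by linarith
  have hq1 : (q : ℝ) - 1 ≠ 0 := by linarith
  -- The product `y * theta (β * y)` is an affine function of `F y`.
  have hprod : HasDerivAt (fun y => y * theta (β * y))
      ((q : ℝ) / (q - 1) * deriv (F q β) x) x := by
    refine ((hd.hasDerivAt.sub_const (1 / (q : ℝ))).const_mul
      ((q : ℝ) / (q - 1))).congr_of_eventuallyEq (Filter.Eventually.of_forall fun y => ?_)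
    simp only [F]
    field_simp
    ring
  set e : ℝ := (q : ℝ) / (q - 1) * deriv (F q β) x with he
  have hev : (fun y => y * theta (β * y)) =ᶠ[nhds x]
      fun y => y * (1 - Real.exp (-β * (y * theta (β * y)))) := by
    filter_upwards [lt_mem_nhds hx] with y hy
    have h := (theta_spec (one_lt_mul_of_inv_lt hq hβ hy)).2
    have harg : -β * (y * theta (β * y)) = -(β * y) * theta (β * y) := by ring
    rw [harg, h]
    ring
  have hrhs := (hasDerivAt_id x).mul (((hprod.const_mul (-β)).exp).const_sub 1)
  have huniq := hprod.unique (hrhs.congr_of_eventuallyEq hev)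
  have hex : Real.exp (-β * (x * theta (β * x))) = 1 - theta (β * x) := by
    rw [← (theta_spec (one_lt_mul_of_inv_lt hq hβ hx)).2]
    ring_nf
  simp only [id, hex] at huniq
  have hF : deriv (F q β) x = (1 - 1 / (q : ℝ)) * e := by
    rw [he]
    field_simp
  rw [hF]
  linear_combination (1 - 1 / (q : ℝ)) * huniq

theorem abs_deriv_F_lt_one_of_fixed {q : ℕ} {β x : ℝ} (hq : (1 : ℝ) < q) (hβ : (q : ℝ) < β)
    (hx : 1 / (q : ℝ) < x) (hfix : F q β x = x) : |deriv (F q β) x| < 1 := by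
  by_cases hd : DifferentiableAt ℝ (F q β) x
  swap
  · rw [deriv_zero_of_not_differentiableAt hd]
    simp
  have hmul := deriv_F_mul hq hβ hx hd
  have hN := driftAuxNum_pos_of_zero hq hβ (theta_spec (one_lt_mul_of_inv_lt hq hβ hx)).1
    (driftAux_theta_of_fixed hq hβ hx hfix)
  have hxD := mul_denom_eq_one_of_fixed hq hfix
  obtain ⟨ht0, ht1⟩ := (theta_spec (one_lt_mul_of_inv_lt hq hβ hx)).1
  set t := theta (β * x)
  have hq0 : (0 : ℝ) < q := by linarith
  have hx0 : 0 < x := lt_trans (by positivity) hx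
  have hc0 : 0 < 1 - 1 / (q : ℝ) := by
    rw [sub_pos, div_lt_one hq0]; exact hq
  have hkey : (1 - t) * (β * x) < 1 - (1 - 1 / (q : ℝ)) * t := by
    have h1 : 1 - (1 - 1 / (q : ℝ)) * t = ((q : ℝ) - (q - 1) * t) / q := by
      field_simp
    rw [h1, lt_div_iff₀ hq0]
    unfold driftAuxNum at hN
    have h2 := mul_pos hx0 hN
    have h3 : x * (((q : ℝ) - (q - 1) * t) ^ 2 - β * q * (1 - t))
        = ((q : ℝ) - (q - 1) * t) - (1 - t) * (β * x) * q := by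
      linear_combination ((q : ℝ) - (q - 1) * t) * hxD
    linarith
  have hct : 0 < (1 - 1 / (q : ℝ)) * t := mul_pos hc0 ht0
  have hpos : 0 < 1 - (1 - t) * (β * x) := by linarith
  rw [eq_div_of_mul_eq hpos.ne' hmul, abs_of_pos (div_pos hct hpos), div_lt_one hpos]
  linarith

/-- Fact 2.1: for `q ≥ 2` and `β > q`, `F` has a unique fixed point
in `(1/q, 1]`, and `|F'| < 1` at that fixed point. -/
theorem drift_fixed_point (q : ℕ) (hq : 2 ≤ q) (β : ℝ) (hβ : (q : ℝ) < β) :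
    (∃! x : ℝ, x ∈ Set.Ioc (1 / (q : ℝ)) 1 ∧ F q β x = x) ∧
      ∀ x : ℝ, x ∈ Set.Ioc (1 / (q : ℝ)) 1 → F q β x = x →
        |deriv (F q β) x| < 1 := by
  have hq1 : (1 : ℝ) < q := by exact_mod_cast hq
  refine ⟨?_, fun x hx hfix => abs_deriv_F_lt_one_of_fixed hq1 hβ hx.1 hfix⟩
  obtain ⟨t, ht, hz⟩ := exists_driftAux_zero hq1 hβ
  refine ⟨((q : ℝ) - (q - 1) * t)⁻¹, fixed_of_driftAux_zero hq1 hβ ht hz, ?_⟩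
  rintro y ⟨hy, hfix⟩
  have hyt : theta (β * y) = t :=
    driftAux_zero_unique hq1 hβ (theta_spec (one_lt_mul_of_inv_lt hq1 hβ hy.1)).1 ht
      (driftAux_theta_of_fixed hq1 hβ hy.1 hfix) hz
  have h := mul_denom_eq_one_of_fixed hq1 hfix
  rw [hyt] at h
  exact eq_inv_of_mul_eq_one_left h
end

section
/- Let q ≥ 2 be an integer and let β > 1 be a real number (so that 1/β < 1). Then F′(x) > 0 and F″(x) < 0 for all x ∈ (1/β, 1]; that is, F is strictly increasing and strictly concave on the interval (1/β, 1]. -/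
open scoped Classical
open Finset

theorem one_sub_exp_neg_pos {s : ℝ} (hs : 0 < s) : 0 < 1 - Real.exp (-s) := by
  rw [sub_pos, Real.exp_lt_one_iff]
  linarith

theorem add_one_mul_exp_neg_lt_one {s : ℝ} (hs : 0 < s) : (s + 1) * Real.exp (-s) < 1 := by
  have h := mul_lt_mul_of_pos_right (Real.add_one_lt_exp hs.ne') (Real.exp_pos (-s))
  rwa [← Real.exp_add, add_neg_cancel, Real.exp_zero] at h

theorem hasDerivAt_exp_neg (s : ℝ) :
    HasDerivAt (fun t : ℝ => Real.exp (-t)) (-Real.exp (-s)) s := by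
  simpa using (hasDerivAt_neg s).exp

theorem sub_two_add_mul_exp_neg_pos {s : ℝ} (hs : 0 < s) :
    0 < s - 2 + (s + 2) * Real.exp (-s) := by
  have hd : ∀ t : ℝ, HasDerivAt (fun t : ℝ => t - 2 + (t + 2) * Real.exp (-t))
      (1 - (t + 1) * Real.exp (-t)) t := fun t => by
    refine (((hasDerivAt_id t).sub_const 2).add
      (((hasDerivAt_id t).add_const 2).mul (hasDerivAt_exp_neg t))).congr_deriv ?_
    simp only [id]
    ring
  have hmono : StrictMonoOn (fun t : ℝ => t - 2 + (t + 2) * Real.exp (-t)) (Set.Ici 0) := by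
    refine strictMonoOn_of_deriv_pos (convex_Ici 0)
      (fun t _ => (hd t).continuousAt.continuousWithinAt) fun t ht => ?_
    rw [interior_Ici] at ht
    rw [(hd t).deriv, sub_pos]
    exact add_one_mul_exp_neg_lt_one ht
  simpa using hmono Set.self_mem_Ici hs.le hs

/-- The mean degree `s / (1 - exp (-s))` expressed through `s = lam * theta lam`;
it is the inverse of `lam ↦ lam * theta lam`. -/
noncomputable def meanDegree (s : ℝ) : ℝ := s / (1 - Real.exp (-s))

/-- The derivative of `meanDegree` on the positive half-line. -/
noncomputable def meanDegreeDeriv (s : ℝ) : ℝ :=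
  (1 - Real.exp (-s) - s * Real.exp (-s)) / (1 - Real.exp (-s)) ^ 2

theorem hasDerivAt_meanDegree {s : ℝ} (hs : 0 < s) :
    HasDerivAt meanDegree (meanDegreeDeriv s) s := by
  refine ((hasDerivAt_id s).div ((hasDerivAt_exp_neg s).const_sub 1)
    (one_sub_exp_neg_pos hs).ne').congr_deriv ?_
  simp [meanDegreeDeriv]

theorem hasDerivAt_meanDegreeDeriv {s : ℝ} (hs : 0 < s) :
    HasDerivAt meanDegreeDeriv
      (Real.exp (-s) * (s - 2 + (s + 2) * Real.exp (-s)) / (1 - Real.exp (-s)) ^ 3) s := by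
  have hE := (one_sub_exp_neg_pos hs).ne'
  refine ((((hasDerivAt_exp_neg s).const_sub 1).sub
    ((hasDerivAt_id s).mul (hasDerivAt_exp_neg s))).div
    (((hasDerivAt_exp_neg s).const_sub 1).pow 2) (pow_ne_zero 2 hE)).congr_deriv ?_
  simp only [id, Pi.sub_apply, Pi.mul_apply, Pi.pow_apply]
  field_simp
  ring

theorem meanDegreeDeriv_pos {s : ℝ} (hs : 0 < s) : 0 < meanDegreeDeriv s := by
  have h := add_one_mul_exp_neg_lt_one hs
  exact div_pos (by linarith) (pow_pos (one_sub_exp_neg_pos hs) 2)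

theorem strictMonoOn_meanDegree : StrictMonoOn meanDegree (Set.Ioi 0) := by
  refine strictMonoOn_of_deriv_pos (convex_Ioi 0)
    (fun t ht => (hasDerivAt_meanDegree ht).continuousAt.continuousWithinAt) fun t ht => ?_
  rw [interior_Ioi] at ht
  rw [(hasDerivAt_meanDegree ht).deriv]
  exact meanDegreeDeriv_pos ht

theorem one_lt_meanDegree {s : ℝ} (hs : 0 < s) : 1 < meanDegree s := by
  rw [meanDegree, one_lt_div (one_sub_exp_neg_pos hs)]
  linarith [Real.add_one_lt_exp (neg_ne_zero.mpr hs.ne')]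

theorem exists_meanDegree_eq {lam : ℝ} (hlam : 1 < lam) : ∃ s, 0 < s ∧ meanDegree s = lam := by
  have hpos : 0 < lam - 1 := sub_pos.mpr hlam
  have hc : ContinuousOn meanDegree (Set.Icc (lam - 1) lam) := fun t ht =>
    (hasDerivAt_meanDegree (hpos.trans_le ht.1)).continuousAt.continuousWithinAt
  have hl : meanDegree (lam - 1) ≤ lam := by
    rw [meanDegree, div_le_iff₀ (one_sub_exp_neg_pos hpos)]
    nlinarith [add_one_mul_exp_neg_lt_one hpos]
  have hr : lam ≤ meanDegree lam := by
    have h0 : 0 < lam := by linarith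
    rw [meanDegree, le_div_iff₀ (one_sub_exp_neg_pos h0)]
    nlinarith [Real.exp_pos (-lam)]
  obtain ⟨s, hs, h⟩ := intermediate_value_Icc (by linarith) hc ⟨hl, hr⟩
  exact ⟨s, hpos.trans_le hs.1, h⟩

theorem theta_meanDegree {s : ℝ} (hs : 0 < s) : theta (meanDegree s) = 1 - Real.exp (-s) := by
  have hE := one_sub_exp_neg_pos hs
  have h1 := one_lt_meanDegree hs
  have hset : {x : ℝ | x ∈ Set.Ioo (0 : ℝ) 1 ∧ Real.exp (-meanDegree s * x) = 1 - x} =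
      {1 - Real.exp (-s)} := by
    ext x
    simp only [Set.mem_ofPred_eq, Set.mem_singleton_iff]
    constructor
    · rintro ⟨⟨hx0, -⟩, hx⟩
      have ht : 0 < meanDegree s * x := mul_pos (by linarith) hx0
      have hx' : 1 - Real.exp (-(meanDegree s * x)) = x := by
        rw [← neg_mul, hx]
        ring
      have heq : meanDegree (meanDegree s * x) = meanDegree s := by
        conv_lhs => rw [meanDegree, hx']
        exact mul_div_cancel_right₀ _ hx0.ne'
      rw [← strictMonoOn_meanDegree.injOn ht hs heq, hx']
    · rintro rfl
      refine ⟨⟨hE, by linarith [Real.exp_pos (-s)]⟩, ?_⟩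
      rw [neg_mul, meanDegree, div_mul_cancel₀ _ hE.ne']
      ring
  rw [theta, if_neg h1.not_ge, hset, csSup_singleton]

/-- The map `lam ↦ lam * theta lam`. -/
noncomputable def mulTheta (lam : ℝ) : ℝ := lam * theta lam

theorem mulTheta_meanDegree {s : ℝ} (hs : 0 < s) : mulTheta (meanDegree s) = s := by
  rw [mulTheta, theta_meanDegree hs, meanDegree, div_mul_cancel₀ _ (one_sub_exp_neg_pos hs).ne']

theorem mulTheta_pos {lam : ℝ} (hlam : 1 < lam) : 0 < mulTheta lam := by
  obtain ⟨s, hs, rfl⟩ := exists_meanDegree_eq hlam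
  rwa [mulTheta_meanDegree hs]

theorem hasDerivAt_mulTheta {lam : ℝ} (hlam : 1 < lam) :
    HasDerivAt mulTheta (meanDegreeDeriv (mulTheta lam))⁻¹ lam := by
  obtain ⟨s, hs, rfl⟩ := exists_meanDegree_eq hlam
  rw [mulTheta_meanDegree hs]
  have hstrict : HasStrictDerivAt meanDegree (meanDegreeDeriv s) s :=
    hasStrictDerivAt_of_hasDerivAt_of_continuousAt
      (Filter.eventually_of_mem (Ioi_mem_nhds hs) fun t ht => hasDerivAt_meanDegree ht)
      (hasDerivAt_meanDegreeDeriv hs).continuousAt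
  exact (hstrict.to_local_left_inverse (meanDegreeDeriv_pos hs).ne'
    (Filter.eventually_of_mem (Ioi_mem_nhds hs) fun t ht => mulTheta_meanDegree ht)).hasDerivAt

theorem exists_neg_hasDerivAt_inv_meanDegreeDeriv {lam : ℝ} (hlam : 1 < lam) :
    ∃ d < 0, HasDerivAt (fun l => (meanDegreeDeriv (mulTheta l))⁻¹) d lam := by
  have hs := mulTheta_pos hlam
  have hp := meanDegreeDeriv_pos hs
  refine ⟨_, ?_, ((hasDerivAt_meanDegreeDeriv hs).comp lam (hasDerivAt_mulTheta hlam)).inv hp.ne'⟩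
  refine div_neg_of_neg_of_pos (neg_neg_of_pos (mul_pos (div_pos (mul_pos (Real.exp_pos _)
    (sub_two_add_mul_exp_neg_pos hs)) (pow_pos (one_sub_exp_neg_pos hs) 3)) (inv_pos.mpr hp)))
    (pow_pos hp 2)

theorem hasDerivAt_F (q : ℕ) {β x : ℝ} (hβ : 0 < β) (hx : 1 / β < x) :
    HasDerivAt (F q β) ((1 - 1 / q) * (meanDegreeDeriv (mulTheta (β * x)))⁻¹) x := by
  have hlam : 1 < β * x := (div_lt_iff₀' hβ).mp hx
  have hF : F q β = fun y => 1 / (q : ℝ) + (1 - 1 / q) / β * mulTheta (β * y) := by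
    ext y
    rw [F, mulTheta]
    field_simp
  rw [hF]
  refine ((((hasDerivAt_mulTheta hlam).comp x
    ((hasDerivAt_id x).const_mul β)).const_mul ((1 - 1 / (q : ℝ)) / β)).const_add
    (1 / (q : ℝ))).congr_deriv ?_
  field_simp

theorem deriv_F_pos {q : ℕ} (hq : 2 ≤ q) {β x : ℝ} (hβ : 0 < β) (hx : 1 / β < x) :
    0 < deriv (F q β) x := by
  have hq' : (1 : ℝ) < q := by exact_mod_cast hq
  rw [(hasDerivAt_F q hβ hx).deriv]
  refine mul_pos (sub_pos.mpr ((div_lt_one (by linarith)).mpr hq')) (inv_pos.mpr ?_)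
  exact meanDegreeDeriv_pos (mulTheta_pos ((div_lt_iff₀' hβ).mp hx))

theorem deriv_deriv_F_neg {q : ℕ} (hq : 2 ≤ q) {β x : ℝ} (hβ : 0 < β) (hx : 1 / β < x) :
    deriv (deriv (F q β)) x < 0 := by
  have hq' : (1 : ℝ) < q := by exact_mod_cast hq
  have hc : 0 < 1 - 1 / (q : ℝ) := sub_pos.mpr ((div_lt_one (by linarith)).mpr hq')
  obtain ⟨d, hd, hderiv⟩ :=
    exists_neg_hasDerivAt_inv_meanDegreeDeriv ((div_lt_iff₀' hβ).mp hx)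
  have heq : deriv (F q β) =ᶠ[nhds x]
      fun y => (1 - 1 / q) * (meanDegreeDeriv (mulTheta (β * y)))⁻¹ :=
    Filter.eventually_of_mem (Ioi_mem_nhds hx) fun y hy => (hasDerivAt_F q hβ hy).deriv
  have h2 := (hderiv.comp x ((hasDerivAt_id x).const_mul β)).const_mul (1 - 1 / (q : ℝ))
  rw [heq.deriv_eq]
  refine h2.deriv.trans_lt (mul_neg_of_pos_of_neg hc (mul_neg_of_neg_of_pos hd ?_))
  linarith

/-- Fact 2.2: for `β > 1`, `F' > 0` and `F'' < 0` on `(1/β, 1]`;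
i.e. `F` is strictly increasing and strictly concave there. -/
theorem drift_increasing_concave (q : ℕ) (hq : 2 ≤ q) (β : ℝ) (hβ : 1 < β) :
    (∀ x ∈ Set.Ioc (1 / β) 1,
        0 < deriv (F q β) x ∧ deriv (deriv (F q β)) x < 0) ∧
      StrictMonoOn (F q β) (Set.Ioc (1 / β) 1) ∧
      StrictConcaveOn ℝ (Set.Ioc (1 / β) 1) (F q β) := by
  have hβ0 : 0 < β := by linarith
  have hc : ContinuousOn (F q β) (Set.Ioc (1 / β) 1) := fun x hx =>
    (hasDerivAt_F q hβ0 hx.1).continuousAt.continuousWithinAt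
  refine ⟨fun x hx => ⟨deriv_F_pos hq hβ0 hx.1, deriv_deriv_F_neg hq hβ0 hx.1⟩, ?_, ?_⟩
  · exact strictMonoOn_of_deriv_pos (convex_Ioc _ _) hc fun x hx =>
      deriv_F_pos hq hβ0 (interior_subset hx).1
  · exact strictConcaveOn_of_deriv2_neg' (convex_Ioc _ _) hc fun x hx =>
      deriv_deriv_F_neg hq hβ0 hx.1
end
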